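/- arXiv:2508.01613 — 2 statements merged into one kernel-verified Lean document; each statement's English description precedes it below -/
import Mathlib

section
/- Let X be a finite indecomposable non-degenerate cycle set whose squaring map T(x) = x·x is a p-cycle for a prime p (i.e., T moves exactly p elements, cyclically). Then X is simple: every surjective cycle set homomorphism from X onto a cycle set Y is either an isomorphism or has |Y| = 1. -/
universe u

lemma avg_roots {n m : ℕ} (hm : 0 < m) (z : Fin n → ℂ) (hz : ∀ i, z i ^ m = 1)
    (hintegral : IsIntegral ℤ ((∑ i, z i) / (n:ℂ))) (h0 : (∑ i, z i) ≠ 0) :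
    ∃ ζ : ℂ, ∀ i, z i = ζ := by
  classical
  have hn : n ≠ 0 := by rintro rfl; simp at h0
  have hnC : (n:ℂ) ≠ 0 := by exact_mod_cast hn
  let S : Set ℂ := Set.range z
  let K := IntermediateField.adjoin ℚ S
  have hzi : ∀ i, IsIntegral ℚ (z i) := fun i =>
    IsIntegral.of_pow hm (by rw [hz]; exact isIntegral_one)
  have : FiniteDimensional ℚ K := IntermediateField.finiteDimensional_adjoin (by
    rintro _ ⟨i, rfl⟩; exact hzi i)
  have : NumberField K := { to_charZero := inferInstance, to_finiteDimensional := inferInstance }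
  let w : Fin n → K := fun i => ⟨z i, IntermediateField.subset_adjoin ℚ S ⟨i, rfl⟩⟩
  let a : K := (∑ i, w i) / (n : K)
  have hwz : ∀ i, ((w i : K) : ℂ) = z i := fun i => rfl
  have ha : ((a : K) : ℂ) = (∑ i, z i) / (n:ℂ) := by
    simp [a, hwz]
  have hw : ∀ i, w i ^ m = 1 := fun i => by
    apply Subtype.ext; simp [hwz, hz]
  have ha0 : a ≠ 0 := by
    intro h
    have : ((a : K) : ℂ) = 0 := by rw [h]; rfl
    rw [ha] at this
    exact div_ne_zero h0 hnC this
  have hai : IsIntegral ℤ a := by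
    rw [← ha] at hintegral
    exact (isIntegral_algHom_iff ((algebraMap K ℂ).toIntAlgHom) (algebraMap K ℂ).injective).1 hintegral
  have hle : ∀ φ : K →+* ℂ, ‖φ a‖ ≤ 1 := by
    intro φ
    have h1 : ∀ i, ‖φ (w i)‖ = 1 := fun i =>
      Complex.norm_eq_one_of_pow_eq_one (n := m) (by rw [← map_pow, hw, map_one]) hm.ne'
    have : φ a = (∑ i, φ (w i)) / (n:ℂ) := by simp [a]
    rw [this, norm_div, Complex.norm_natCast]
    rw [div_le_one (by positivity)]
    calc _ ≤ ∑ i, ‖φ (w i)‖ := norm_sum_le _ _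
      _ = n := by simp [h1]
  obtain ⟨k, hk, hak⟩ := NumberField.Embeddings.pow_eq_one_of_norm_le_one K ℂ ha0 hai hle
  set α : ℂ := (∑ i, z i) / (n:ℂ) with hα
  have hαk : α ^ k = 1 := by
    rw [← ha]; exact_mod_cast congrArg (fun x : K => (x:ℂ)) hak
  have hα1 : ‖α‖ = 1 := Complex.norm_eq_one_of_pow_eq_one hαk hk.ne'
  have hz1 : ∀ i, ‖z i‖ = 1 := fun i => Complex.norm_eq_one_of_pow_eq_one (hz i) hm.ne'
  have hαα : α * (starRingEnd ℂ) α = 1 := by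
    rw [Complex.mul_conj, Complex.normSq_eq_norm_sq, hα1]; simp
  have hsum : ∑ i, (1 - (z i * (starRingEnd ℂ) α).re) = 0 := by
    rw [Finset.sum_sub_distrib, ← Complex.re_sum, ← Finset.sum_mul]
    have : ∑ i, z i = n * α := by rw [hα]; field_simp
    rw [this, mul_assoc, hαα]; simp
  have hnn : ∀ i ∈ Finset.univ, 0 ≤ (1 - (z i * (starRingEnd ℂ) α).re) := by
    intro i _
    have := Complex.re_le_norm (z i * (starRingEnd ℂ) α)
    rw [norm_mul, hz1, RCLike.norm_conj, hα1] at this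
    linarith
  refine ⟨α, fun i => ?_⟩
  have h1 := (Finset.sum_eq_zero_iff_of_nonneg hnn).1 hsum i (Finset.mem_univ _)
  have h2 : ‖z i * (starRingEnd ℂ) α‖ = 1 := by rw [norm_mul, hz1, RCLike.norm_conj, hα1]; simp
  have h3 : z i * (starRingEnd ℂ) α = 1 := by
    have hre : (z i * (starRingEnd ℂ) α).re = 1 := by linarith
    have hsq := Complex.normSq_eq_norm_sq (z i * (starRingEnd ℂ) α)
    rw [h2, Complex.normSq_apply, hre] at hsq
    have him : (z i * (starRingEnd ℂ) α).im = 0 := by nlinarith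
    exact Complex.ext (by simpa using hre) (by simpa using him)
  calc z i = z i * (α * (starRingEnd ℂ) α) := by rw [hαα, mul_one]
    _ = (z i * (starRingEnd ℂ) α) * α := by ring
    _ = α := by rw [h3, one_mul]

open Polynomial in
lemma scalar_of_trace {n m : ℕ} (hm : 0 < m) (M : Matrix (Fin n) (Fin n) ℂ) (hM : M ^ m = 1)
    (hintegral : IsIntegral ℤ (M.trace / (n:ℂ))) (h0 : M.trace ≠ 0) :
    ∃ ζ : ℂ, M = ζ • (1 : Matrix (Fin n) (Fin n) ℂ) := by
  classical

  have htr := Matrix.trace_eq_sum_roots_charpoly M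
  have hsp : M.charpoly.Splits := IsAlgClosed.splits _
  have hcard : M.charpoly.roots.card = n := by
    rw [← hsp.natDegree_eq_card_roots, Matrix.charpoly_natDegree_eq_dim]; simp
  obtain ⟨z, hz⟩ : ∃ z : Fin n → ℂ, M.charpoly.roots = Multiset.map z Finset.univ.val := by
    obtain ⟨l, hl⟩ := Quot.exists_rep M.charpoly.roots
    have hl' : (l : Multiset ℂ) = M.charpoly.roots := hl
    have hlen : l.length = n := by rw [← hcard, ← hl']; simp
    subst hlen
    refine ⟨l.get, ?_⟩
    rw [← hl', Fin.univ_val_map, List.ofFn_get]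
  have hroot : ∀ i, M.charpoly.IsRoot (z i) := by
    intro i
    apply isRoot_of_mem_roots
    rw [hz]; simp
  have hroot2 : ∀ x, M.charpoly.IsRoot x → x ^ m = 1 := by
    intro x hx
    have h1 : x ∈ spectrum ℂ M := (Matrix.mem_spectrum_iff_isRoot_charpoly).2 hx
    have h2 := spectrum.pow_mem_pow M m h1
    rw [hM] at h2
    by_contra hne
    apply h2
    have : IsUnit (x ^ m - 1) := (sub_ne_zero.2 hne).isUnit
    have h3 := this.map (algebraMap ℂ (Matrix (Fin n) (Fin n) ℂ))
    rw [spectrum.mem_resolventSet_iff]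
    simpa using h3
  have hsum : M.trace = ∑ i, z i := by rw [htr, hz]; rfl
  rw [hsum] at hintegral h0
  obtain ⟨ζ, hζ⟩ := avg_roots hm z (fun i => hroot2 _ (hroot i)) hintegral h0
  have hn : n ≠ 0 := by rintro rfl; simp at h0
  have hζm : ζ ^ m = 1 := by
    rw [← hζ ⟨0, Nat.pos_of_ne_zero hn⟩]; exact hroot2 _ (hroot _)
  have hchar : M.charpoly = (X - C ζ) ^ n := by
    rw [hsp.eq_prod_roots_of_monic M.charpoly_monic, hz]
    simp [hζ]
  have hq : (X ^ m - 1 : ℂ[X]).Separable :=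
    separable_X_pow_sub_C (1:ℂ) (by exact_mod_cast hm.ne') one_ne_zero
  obtain ⟨u, hu⟩ : (X - C ζ) ∣ (X ^ m - 1 : ℂ[X]) := by
    rw [dvd_iff_isRoot]; simp [hζm]
  have hcop : IsCoprime (M.charpoly) u := by
    rw [hchar]
    rw [hu] at hq
    exact hq.isCoprime.pow_left
  obtain ⟨a, b, hab⟩ := hcop
  have h1 : aeval M b * aeval M u = 1 := by
    have := congrArg (aeval M) hab
    simpa [Matrix.aeval_self_charpoly] using this
  have h2 : aeval M (X - C ζ) * aeval M u = 0 := by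
    rw [← map_mul, ← hu]; simp [hM]
  refine ⟨ζ, ?_⟩
  have h3 : aeval M u * aeval M b = 1 := by rw [← h1, ← map_mul, ← map_mul, mul_comm]
  have h4 : aeval M (X - C ζ) = 0 := by
    calc aeval M (X - C ζ) = aeval M (X - C ζ) * (aeval M u * aeval M b) := by rw [h3, mul_one]
      _ = 0 := by rw [← mul_assoc, h2, zero_mul]
  simp only [map_sub, aeval_X, aeval_C, sub_eq_zero] at h4
  rw [h4, Algebra.algebraMap_eq_smul_one]

open Polynomial in
lemma trace_integral {n m : ℕ} (hm : 0 < m) (M : Matrix (Fin n) (Fin n) ℂ) (hM : M ^ m = 1) :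
    IsIntegral ℤ M.trace := by
  rw [Matrix.trace_eq_sum_roots_charpoly M]
  have hroot2 : ∀ x, M.charpoly.IsRoot x → x ^ m = 1 := by
    intro x hx
    have h1 : x ∈ spectrum ℂ M := (Matrix.mem_spectrum_iff_isRoot_charpoly).2 hx
    have h2 := spectrum.pow_mem_pow M m h1
    rw [hM] at h2
    by_contra hne
    apply h2
    have : IsUnit (x ^ m - 1) := (sub_ne_zero.2 hne).isUnit
    have h3 := this.map (algebraMap ℂ (Matrix (Fin n) (Fin n) ℂ))
    rw [spectrum.mem_resolventSet_iff]
    simpa using h3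
  apply IsIntegral.multiset_sum
  intro x hx
  exact IsIntegral.of_pow hm (by rw [hroot2 x (isRoot_of_mem_roots hx)]; exact isIntegral_one)

lemma trace_pi {k : ℕ} (d : Fin k → ℕ) (M : Π i, Matrix (Fin (d i)) (Fin (d i)) ℂ) :
    LinearMap.trace ℂ _ (LinearMap.mulLeft ℂ M) = ∑ i, (d i : ℂ) * (M i).trace := by
  classical
  rw [LinearMap.trace_eq_matrix_trace ℂ (Pi.basis fun i => Matrix.stdBasis ℂ (Fin (d i)) (Fin (d i)))]
  rw [Matrix.trace, Fintype.sum_sigma]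
  refine Finset.sum_congr rfl fun i _ => ?_
  rw [Fintype.sum_prod_type]
  simp [LinearMap.toMatrix_apply, Matrix.trace, Matrix.diag, Pi.basis_apply, Pi.basis_repr, Finset.mul_sum, Matrix.stdBasis]
  refine Finset.sum_congr rfl fun x _ => ?_
  have h : ∀ y, (M i * Matrix.of (Pi.single x (Pi.single y 1)) : Matrix _ _ ℂ) x y = M i x x := by
    intro y
    rw [Matrix.mul_apply, Finset.sum_eq_single x]
    · simp
    · intro b _ hb
      simp [Pi.single_eq_of_ne hb]
    · simp
  simp [h]

lemma trace_reg {G : Type*} [Group G] [Fintype G] (g : G) (hg : g ≠ 1) :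
    LinearMap.trace ℂ (MonoidAlgebra ℂ G) (LinearMap.mulLeft ℂ (MonoidAlgebra.single g (1:ℂ))) = 0 := by
  classical
  rw [LinearMap.trace_eq_matrix_trace ℂ (MonoidAlgebra.basis G ℂ), Matrix.trace]
  refine Finset.sum_eq_zero fun i _ => ?_
  rw [Matrix.diag_apply, LinearMap.toMatrix_apply]
  have h : g * i ≠ i := by simpa using hg
  simp [MonoidAlgebra.basis, MonoidAlgebra.single_mul_single]
  exact Finsupp.single_eq_of_ne (Ne.symm h)


lemma not_integral_inv_prime {p : ℕ} (hp : p.Prime) (β : ℂ) (hβ : IsIntegral ℤ β) (h : (p:ℂ) * β = -1) :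
    False := by
  have hp0 : (p:ℂ) ≠ 0 := by exact_mod_cast hp.ne_zero
  have hpQ : (p:ℚ) ≠ 0 := by exact_mod_cast hp.ne_zero
  have h1 : β = algebraMap ℚ ℂ (-1 / p) := by
    simp; field_simp; linear_combination h
  rw [h1] at hβ
  have h2 : IsIntegral ℤ (-1 / (p:ℚ)) :=
    (isIntegral_algHom_iff ((algebraMap ℚ ℂ).toIntAlgHom) (algebraMap ℚ ℂ).injective).1 hβ
  obtain ⟨y, hy⟩ := IsIntegrallyClosed.isIntegral_iff.1 h2
  have h3 : (y:ℚ) * p = -1 := by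
    rw [eq_div_iff hpQ] at hy; simpa using hy
  have h4 : y * (p:ℤ) = -1 := by exact_mod_cast h3
  have h5 : (p:ℤ) ∣ 1 := ⟨-y, by linear_combination h4⟩
  have h6 : p ∣ 1 := by exact_mod_cast h5
  exact hp.one_lt.ne' (Nat.dvd_one.1 h6)

/-- class sum eigenvalue: key integrality for one matrix component. -/
lemma comp_step {G : Type*} [Group G] [Fintype G] {n : ℕ} (hn : n ≠ 0)
    (ρ : MonoidAlgebra ℂ G →ₐ[ℂ] Matrix (Fin n) (Fin n) ℂ) (hρ : Function.Surjective ρ)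
    (C : Finset G) (g : G) (hC : ∀ h, h ∈ C ↔ IsConj g h) (hcop : Nat.Coprime C.card n) :
    IsIntegral ℤ ((ρ (MonoidAlgebra.single g 1)).trace / (n:ℂ)) := by
  classical
  have hn' : NeZero n := ⟨hn⟩
  have hnC : (n:ℂ) ≠ 0 := by exact_mod_cast hn
  set cs : MonoidAlgebra ℂ G := ∑ h ∈ C, MonoidAlgebra.single h 1 with hcs
  have hcent : ∀ x : G, MonoidAlgebra.single x (1:ℂ) * cs = cs * MonoidAlgebra.single x 1 := by
    intro x
    rw [hcs, Finset.mul_sum, Finset.sum_mul]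
    refine Finset.sum_bij' (fun h _ => x * h * x⁻¹) (fun h _ => x⁻¹ * h * x) ?_ ?_ ?_ ?_ ?_
    · intro h hh
      rw [hC] at hh ⊢
      exact hh.trans (isConj_iff.2 ⟨x, rfl⟩)
    · intro h hh
      rw [hC] at hh ⊢
      exact hh.trans (isConj_iff.2 ⟨x⁻¹, by simp⟩)
    · intro h _; group
    · intro h _; group
    · intro h _; simp [MonoidAlgebra.single_mul_single]
  have hcent2 : ∀ y : MonoidAlgebra ℂ G, y * cs = cs * y := by
    intro y
    induction y using MonoidAlgebra.induction_on with
    | of x => exact hcent x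
    | add a b ha hb => rw [add_mul, mul_add, ha, hb]
    | smul r a ha => rw [smul_mul_assoc, mul_smul_comm, ha]
  obtain ⟨ω, hω⟩ : ρ cs ∈ Set.range (Matrix.scalar (Fin n)) := by
    apply Matrix.mem_range_scalar_of_commute_single
    intro i j _
    obtain ⟨y, hy⟩ := hρ (Matrix.single i j 1)
    rw [← hy]
    show _ * _ = _ * _
    rw [← map_mul, hcent2, map_mul]
  have hωint : IsIntegral ℤ ω := by
    let cz : MonoidAlgebra ℤ G := ∑ h ∈ C, MonoidAlgebra.single h 1
    have h1 : IsIntegral ℤ cz := IsIntegral.of_finite ℤ cz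
    let F : MonoidAlgebra ℤ G →+* Matrix (Fin n) (Fin n) ℂ :=
      (ρ : MonoidAlgebra ℂ G →+* _).comp (MonoidAlgebra.mapRingHom G (Int.castRingHom ℂ))
    have h2 : IsIntegral ℤ (F cz) := h1.map F.toIntAlgHom
    have h3 : F cz = (Matrix.scalar (Fin n)) ω := by
      rw [hω]
      simp [F, cz, hcs]
    rw [h3] at h2
    exact (isIntegral_algHom_iff ((Matrix.scalar (Fin n) : ℂ →+* _).toIntAlgHom)
      (RingHom.injective _)).1 h2
  set t := (ρ (MonoidAlgebra.single g 1)).trace with ht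
  have htr : (C.card : ℂ) * t = ω * n := by
    have h1 : (ρ cs).trace = ω * n := by
      rw [← hω]; simp [Matrix.trace, mul_comm]
    rw [← h1, hcs, map_sum, Matrix.trace_sum]
    rw [Finset.sum_congr rfl (g := fun _ => t)]
    · simp
    · intro h hh
      obtain ⟨c, hc⟩ := isConj_iff.1 ((hC h).1 hh)
      have : (MonoidAlgebra.single h (1:ℂ)) = MonoidAlgebra.single c 1 *
          MonoidAlgebra.single g 1 * MonoidAlgebra.single c⁻¹ 1 := by
        simp [MonoidAlgebra.single_mul_single, hc]
      rw [this, map_mul, map_mul, Matrix.trace_mul_cycle, ← map_mul]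
      simp [MonoidAlgebra.single_mul_single, ht]
      rw [← MonoidAlgebra.one_def]; simp
  have htint : IsIntegral ℤ t := by
    refine trace_integral (Fintype.card_pos (α := G)) _ ?_
    rw [← map_pow, MonoidAlgebra.single_pow, pow_card_eq_one, one_pow, ← MonoidAlgebra.one_def, map_one]
  have hbez := Nat.gcd_eq_gcd_ab C.card n
  rw [hcop] at hbez
  have hbez' : (1:ℂ) = C.card * (C.card.gcdA n : ℂ) + n * (C.card.gcdB n : ℂ) := by exact_mod_cast hbez
  have : t / n = (C.card.gcdA n : ℤ) • ω + (C.card.gcdB n : ℤ) • t := by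
    rw [div_eq_iff hnC]
    simp only [zsmul_eq_mul]
    linear_combination t * hbez' + (C.card.gcdA n : ℂ) * htr
  rw [this]
  exact (hωint.smul _).add (htint.smul _)

theorem burnside_class {G : Type*} [Group G] [Fintype G] (p k : ℕ) (hp : p.Prime) (g : G)
    (C : Finset G) (hC : ∀ h, h ∈ C ↔ IsConj g h) (hcard : C.card = p ^ k)
    (hg : g ∉ Subgroup.center G) : ¬ IsSimpleGroup G := by
  classical
  intro hsimple
  have hg1 : g ≠ 1 := by rintro rfl; exact hg (one_mem _)
  obtain ⟨N, d, hd, ⟨e⟩⟩ :=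
    IsSemisimpleRing.exists_algEquiv_pi_matrix_of_isAlgClosed ℂ (MonoidAlgebra ℂ G)
  let ρ : ∀ i, MonoidAlgebra ℂ G →ₐ[ℂ] Matrix (Fin (d i)) (Fin (d i)) ℂ := fun i =>
    (Pi.evalAlgHom ℂ (fun i => Matrix (Fin (d i)) (Fin (d i)) ℂ) i).comp (e : MonoidAlgebra ℂ G →ₐ[ℂ] _)
  have hρe : ∀ i x, ρ i x = e x i := fun i x => rfl
  have hρs : ∀ i, Function.Surjective (ρ i) := by
    intro i M
    refine ⟨e.symm (Pi.single i M), ?_⟩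
    simp [hρe]
  have htrace : ∑ i, (d i : ℂ) * (ρ i (MonoidAlgebra.single g 1)).trace = 0 := by
    rw [← trace_reg g hg1]
    have := trace_pi d (e (MonoidAlgebra.single g 1))
    simp only [hρe]
    rw [← this, ← LinearMap.trace_conj' _ e.toLinearEquiv]
    congr 1
    refine LinearMap.ext fun x => ?_
    simp [LinearEquiv.conj_apply]
  obtain ⟨i0, hi0⟩ : ∃ i, ∀ h : G, ρ i (MonoidAlgebra.single h 1) = 1 := by
    set s : MonoidAlgebra ℂ G := ∑ h : G, MonoidAlgebra.single h 1 with hs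
    have hsl : ∀ x : G, MonoidAlgebra.single x (1:ℂ) * s = s := by
      intro x
      rw [hs, Finset.mul_sum]
      simp only [MonoidAlgebra.single_mul_single, one_mul]
      exact Equiv.sum_comp (Equiv.mulLeft x) (fun h => MonoidAlgebra.single h (1:ℂ))
    have hsr : ∀ x : G, s * MonoidAlgebra.single x (1:ℂ) = s := by
      intro x
      rw [hs, Finset.sum_mul]
      simp only [MonoidAlgebra.single_mul_single, one_mul]
      exact Equiv.sum_comp (Equiv.mulRight x) (fun h => MonoidAlgebra.single h (1:ℂ))
    have hs0 : s ≠ 0 := by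
      intro h0
      have := congrArg (fun f : MonoidAlgebra ℂ G => (MonoidAlgebra.lift ℂ ℂ G 1) f) h0
      simp [hs] at this
    have he0 : e s ≠ 0 := by simpa using hs0
    obtain ⟨i, hi⟩ := Function.ne_iff.1 he0
    refine ⟨i, fun h => ?_⟩
    have hcent2 : ∀ y : MonoidAlgebra ℂ G, y * s = s * y := by
      intro y
      induction y using MonoidAlgebra.induction_on with
      | of x => exact (hsl x).trans (hsr x).symm
      | add a b ha hb => rw [add_mul, mul_add, ha, hb]
      | smul r a ha => rw [smul_mul_assoc, mul_smul_comm, ha]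
    obtain ⟨ω, hω⟩ : ρ i s ∈ Set.range (Matrix.scalar (Fin (d i))) := by
      apply Matrix.mem_range_scalar_of_commute_single
      intro a b _
      obtain ⟨y, hy⟩ := hρs i (Matrix.single a b 1)
      rw [← hy]
      show _ * _ = _ * _
      rw [← map_mul, hcent2, map_mul]
    have hω0 : ω ≠ 0 := by
      rintro rfl
      apply hi
      rw [← hρe, ← hω]; simp
    have h1 : ρ i (MonoidAlgebra.single h 1) * ρ i s = ρ i s := by rw [← map_mul, hsl]
    rw [← hω] at h1
    have h2 : Matrix.scalar (Fin (d i)) ω * Matrix.scalar (Fin (d i)) ω⁻¹ = 1 := by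
      rw [← map_mul, mul_inv_cancel₀ hω0, map_one]
    calc ρ i (MonoidAlgebra.single h 1)
        = ρ i (MonoidAlgebra.single h 1) * (Matrix.scalar (Fin (d i)) ω * Matrix.scalar (Fin (d i)) ω⁻¹) := by
          rw [h2, mul_one]
      _ = 1 := by rw [← mul_assoc, h1, h2]
  let ε : MonoidAlgebra ℂ G →ₐ[ℂ] ℂ := MonoidAlgebra.lift ℂ ℂ G 1
  have htriv : ∀ i, (∀ h : G, ρ i (MonoidAlgebra.single h 1) = 1) →
      ∀ y, ρ i y = ε y • (1 : Matrix (Fin (d i)) (Fin (d i)) ℂ) := by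
    intro i hi y
    induction y using MonoidAlgebra.induction_on with
    | of x => rw [MonoidAlgebra.of_apply, hi]; simp [ε]
    | add a b ha hb => rw [map_add, map_add, ha, hb, add_smul]
    | smul r a ha => rw [map_smul, map_smul, ha, smul_assoc]
  have hdi0 : d i0 = 1 := by
    have hsub : Subsingleton (Fin (d i0)) := by
      refine ⟨fun a b => ?_⟩
      by_contra hab
      obtain ⟨y, hy⟩ := hρs i0 (Matrix.single a b 1)
      rw [htriv i0 hi0] at hy
      have := congrFun (congrFun hy a) b
      simp [hab] at this
    have h1 := Fin.subsingleton_iff_le_one.1 hsub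
    have h2 := (hd i0).out
    omega
  have hother : ∀ i, i ≠ i0 → ∃ β : ℂ, IsIntegral ℤ β ∧
      (d i : ℂ) * (ρ i (MonoidAlgebra.single g 1)).trace = p * β := by
    intro i hi
    have hpow : (ρ i (MonoidAlgebra.single g 1)) ^ Fintype.card G = 1 := by
      rw [← map_pow, MonoidAlgebra.single_pow, pow_card_eq_one, one_pow, ← MonoidAlgebra.one_def,
        map_one]
    have htint := trace_integral (Fintype.card_pos (α := G)) _ hpow
    by_cases hpd : p ∣ d i
    · obtain ⟨m, hm⟩ := hpd
      refine ⟨(m:ℤ) • (ρ i (MonoidAlgebra.single g 1)).trace, htint.smul _, ?_⟩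
      have hm' : (d i : ℂ) = p * m := by exact_mod_cast hm
      rw [hm']; simp [mul_assoc]
    · refine ⟨0, isIntegral_zero, ?_⟩
      suffices h : (ρ i (MonoidAlgebra.single g 1)).trace = 0 by rw [h]; simp
      by_contra hne
      have hcop : Nat.Coprime C.card (d i) := by
        rw [hcard]; exact Nat.Coprime.pow_left _ ((Nat.Prime.coprime_iff_not_dvd hp).2 hpd)
      have hintegral := comp_step (hd i).out (ρ i) (hρs i) C g hC hcop
      obtain ⟨ζ, hζ⟩ := scalar_of_trace (Fintype.card_pos (α := G)) _ hpow hintegral hne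
      let f : G →* Matrix (Fin (d i)) (Fin (d i)) ℂ := ((ρ i : _ →* _)).comp (MonoidAlgebra.of ℂ G)
      have hf : ∀ h, f h = ρ i (MonoidAlgebra.single h 1) := fun h => rfl
      have hker : f.ker = ⊥ := by
        rcases (inferInstance : f.ker.Normal).eq_bot_or_eq_top with h | h
        · exact h
        · exfalso
          have hi1 : ∀ h : G, ρ i (MonoidAlgebra.single h 1) = 1 := by
            intro x
            have : x ∈ f.ker := by rw [h]; trivial
            exact this
          have hy0 := htriv i0 hi0 (e.symm (Pi.single i 1))
          have hy1 := htriv i hi1 (e.symm (Pi.single i 1))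
          rw [hρe, e.apply_symm_apply] at hy0 hy1
          rw [Pi.single_eq_of_ne (Ne.symm hi)] at hy0
          rw [Pi.single_eq_same] at hy1
          have hn0 : Nonempty (Fin (d i0)) := by rw [hdi0]; infer_instance
          have := hd i
          have hz : ε (e.symm (Pi.single i 1)) = 0 := by
            by_contra hnz
            exact (smul_ne_zero hnz one_ne_zero) hy0.symm
          rw [hz, zero_smul] at hy1
          exact one_ne_zero hy1
      apply hg
      rw [Subgroup.mem_center_iff]
      intro h
      have hcomm : f g * f h = f h * f g := by
        rw [hf g, hζ]; simp
      have : h * g * h⁻¹ * g⁻¹ ∈ f.ker := by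
        rw [MonoidHom.mem_ker, map_mul, map_mul, map_mul, ← hcomm, mul_assoc (f g), ← map_mul f h,
          mul_inv_cancel, map_one, mul_one, ← map_mul, mul_inv_cancel, map_one]
      rw [hker, Subgroup.mem_bot] at this
      have h5 : h * g = g * h := by
        have := congrArg (fun x => x * (g * h)) this
        simpa [mul_assoc] using this
      exact h5
  choose! β hβ using hother
  rw [← Finset.add_sum_erase _ _ (Finset.mem_univ i0), hi0,
    Finset.sum_congr rfl (fun i hi => (hβ i (Finset.ne_of_mem_erase hi)).2), ← Finset.mul_sum] at htrace
  refine not_integral_inv_prime hp (∑ i ∈ Finset.univ.erase i0, β i) ?_ ?_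
  · exact IsIntegral.sum _ fun i hi => (hβ i (Finset.ne_of_mem_erase hi)).1
  · have : (d i0 : ℂ) * (1 : Matrix (Fin (d i0)) (Fin (d i0)) ℂ).trace = 1 := by
      rw [Matrix.trace_one, Fintype.card_fin, hdi0]; simp
    rw [this] at htrace
    linear_combination htrace

lemma solvable_ext {G : Type*} [Group G] (N : Subgroup G) [N.Normal] (h1 : Group.IsSolvable N)
    (h2 : Group.IsSolvable (G ⧸ N)) : Group.IsSolvable G :=
  Group.isSolvable_of_ker_le_range N.subtype (QuotientGroup.mk' N) (by simp)

lemma eq_prime_pow_of_primes {n q : ℕ} (hn : n ≠ 0)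
    (h : ∀ r, r.Prime → r ∣ n → r = q) : ∃ k, n = q ^ k :=
  ⟨_, Nat.eq_prime_pow_of_unique_prime_dvd hn (fun {d} hd hdn => h d hd hdn)⟩

theorem paqb_aux {G : Type*} [Group G] [Finite G] (hs : IsSimpleGroup G) (p q : ℕ) (hp : p.Prime)
    (hq : q.Prime)
    (hpG : p ∣ Nat.card G) (hG : ∀ r, r.Prime → r ∣ Nat.card G → r = p ∨ r = q) :
    Subgroup.center G = ⊤ := by
  classical
  have := Fintype.ofFinite G
  have : Fact p.Prime := ⟨hp⟩
  by_contra hc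
  have hc' : Subgroup.center G = ⊥ := (Subgroup.Normal.eq_bot_or_eq_top inferInstance).resolve_right hc
  obtain ⟨P⟩ := (inferInstance : Nonempty (Sylow p G))
  have hPn : Nontrivial P := by
    rw [← Finite.one_lt_card_iff_nontrivial]
    have h1 := P.card_eq_multiplicity
    rw [Nat.card_eq_fintype_card (α := P)] at h1
    rw [Nat.card_eq_fintype_card (α := P), h1]
    apply Nat.one_lt_pow _ hp.one_lt
    exact (hp.factorization_pos_of_dvd Nat.card_pos.ne' hpG).ne'
  have hZ := P.isPGroup'.center_nontrivial
  obtain ⟨z, hz⟩ := exists_ne (1 : Subgroup.center P)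
  set g : G := ((z : P) : G) with hg
  have hg1 : g ≠ 1 := by
    intro h
    apply hz
    apply Subtype.ext; apply Subtype.ext; exact h
  have hgc : g ∉ Subgroup.center G := by
    rw [hc', Subgroup.mem_bot]; exact hg1
  have hPle : (P : Subgroup G) ≤ Subgroup.centralizer {g} := by
    intro x hx
    rw [Subgroup.mem_centralizer_singleton_iff]
    have := (Subgroup.mem_center_iff.1 z.2) ⟨x, hx⟩
    exact (congrArg Subtype.val this)
  have hdvd := Subgroup.index_dvd_of_le hPle
  have hndvd : ¬ p ∣ (Subgroup.centralizer {g}).index := fun h =>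
    P.not_dvd_index (h.trans hdvd)
  obtain ⟨k, hk⟩ : ∃ k, (Subgroup.centralizer {g}).index = q ^ k := by
    apply eq_prime_pow_of_primes Subgroup.index_ne_zero_of_finite
    intro r hr hrd
    rcases hG r hr (hrd.trans (Subgroup.index_dvd_card _)) with rfl | h
    · exact absurd hrd hndvd
    · exact h
  have hcard : (Finset.univ.filter (fun h => IsConj g h)).card = q ^ k := by
    rw [← hk]
    have h1 := MulAction.index_stabilizer (ConjAct G) g
    rw [ConjAct.stabilizer_eq_centralizer] at h1
    have h2 : (MulAction.orbit (ConjAct G) g) = ((Finset.univ.filter (fun h => IsConj g h) : Finset G) : Set G) := by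
      ext x
      rw [ConjAct.mem_orbit_conjAct]
      rw [isConj_comm]; simp
    rw [h2, Set.ncard_coe_finset] at h1
    rw [← h1]
    rfl
  exact burnside_class q k hq g _ (by simp) hcard hgc hs

theorem paqb {G : Type*} [Group G] [Finite G] (p q : ℕ) (hp : p.Prime) (hq : q.Prime)
    (hG : ∀ r, r.Prime → r ∣ Nat.card G → r = p ∨ r = q) : Group.IsSolvable G := by
  classical
  induction hn : Nat.card G using Nat.strong_induction_on generalizing G with
  | _ n ih =>
  subst hn
  rcases subsingleton_or_nontrivial G with h | h
  · infer_instance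
  by_cases hs : IsSimpleGroup G
  · have hct : Subgroup.center G = ⊤ := by
      obtain ⟨r, hr, hrd⟩ := Nat.exists_prime_and_dvd (n := Nat.card G) (Finite.one_lt_card (α := G)).ne'
      rcases hG r hr hrd with rfl | rfl
      · exact paqb_aux hs r q hr hq hrd hG
      · exact paqb_aux hs r p hr hp hrd (fun s hs hd => (hG s hs hd).symm)
    apply Group.isSolvable_of_comm
    intro a b
    have : a ∈ Subgroup.center G := by rw [hct]; trivial
    exact ((Subgroup.mem_center_iff.1 this) b).symm
  · obtain ⟨N, hN, hb, ht⟩ : ∃ N : Subgroup G, N.Normal ∧ N ≠ ⊥ ∧ N ≠ ⊤ := by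
      by_contra hcon
      push Not at hcon
      exact hs ⟨fun N hN => or_iff_not_imp_left.2 (hcon N hN)⟩
    have h1 : Nat.card N < Nat.card G := by
      refine lt_of_le_of_ne (Subgroup.card_le_card_group N) fun h => ht (Subgroup.eq_top_of_card_eq N h)
    have h3 := Subgroup.card_mul_index N
    have h4 : 1 < Nat.card N := (Subgroup.one_lt_card_iff_ne_bot N).2 hb
    have h2 : Nat.card (G ⧸ N) < Nat.card G := by
      rw [← Subgroup.index_eq_card, ← h3]
      have : 0 < N.index := Nat.pos_of_ne_zero Subgroup.index_ne_zero_of_finite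
      nlinarith
    refine solvable_ext N (ih _ h1 (fun r hr hd => hG r hr (hd.trans (Subgroup.card_subgroup_dvd_card N))) rfl)
      (ih _ h2 (fun r hr hd => hG r hr (hd.trans (Subgroup.card_quotient_dvd_card N))) rfl)

lemma coprime_mul {G : Type*} [Group G] [Finite G] (H K : Subgroup G)
    (h : Nat.Coprime H.index K.index) (g : G) : ∃ a ∈ H, ∃ b ∈ K, g = a * b := by
  classical
  have h1 : H.index * K.index ∣ (K ⊓ H).index :=
    Nat.Coprime.mul_dvd_of_dvd_of_dvd h (Subgroup.index_dvd_of_le inf_le_right)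
      (Subgroup.index_dvd_of_le inf_le_left)
  have h2 : K.relIndex H * H.index = (K ⊓ H).index := by
    rw [← Subgroup.inf_relIndex_right]; exact Subgroup.relIndex_mul_index inf_le_right
  have hH : 0 < H.index := Nat.pos_of_ne_zero Subgroup.index_ne_zero_of_finite
  have hKH : 0 < K.relIndex H := Nat.pos_of_ne_zero Subgroup.index_ne_zero_of_finite
  have h3 : K.index ≤ K.relIndex H := by
    rw [← h2, mul_comm] at h1
    exact Nat.le_of_dvd hKH (Nat.dvd_of_mul_dvd_mul_right hH h1)
  have h4 := MulAction.index_stabilizer H ((1 : G) : G ⧸ K)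
  have h5 : MulAction.stabilizer H ((1 : G) : G ⧸ K) = K.subgroupOf H := by
    ext x
    rw [MulAction.mem_stabilizer_iff, Subgroup.mem_subgroupOf]
    show ((x.1 * 1 : G) : G ⧸ K) = _ ↔ _
    rw [mul_one, eq_comm, QuotientGroup.eq]; simp
  rw [h5] at h4
  have h6 : MulAction.orbit H ((1 : G) : G ⧸ K) = Set.univ := by
    apply Set.eq_of_subset_of_ncard_le (Set.subset_univ _)
    rw [← h4, Set.ncard_univ, ← Subgroup.index_eq_card]; exact h3
  have h7 : (g : G ⧸ K) ∈ MulAction.orbit H ((1 : G) : G ⧸ K) := by rw [h6]; trivial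
  obtain ⟨x, hx⟩ := h7
  have hx' : ((x.1 * 1 : G) : G ⧸ K) = (g : G ⧸ K) := hx
  rw [mul_one, QuotientGroup.eq] at hx'
  exact ⟨x, x.2, _, hx', by group⟩

lemma exists_normal_pgroup {H : Type*} [Group H] [Finite H] [Nontrivial H] (hs : Group.IsSolvable H) :
    ∃ (p : ℕ) (N : Subgroup H), p.Prime ∧ N.Normal ∧ N ≠ ⊥ ∧ IsPGroup p N := by
  classical
  obtain ⟨n, hn⟩ := hs.solvable
  have hex : ∃ n, derivedSeries H n = ⊥ := ⟨n, hn⟩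
  have hk := Nat.find_spec hex
  have hk0 : Nat.find hex ≠ 0 := by
    intro h0
    rw [h0, derivedSeries_zero] at hk
    exact bot_ne_top hk.symm
  obtain ⟨k, hkk⟩ := Nat.exists_eq_succ_of_ne_zero hk0
  have hmin : derivedSeries H k ≠ ⊥ := Nat.find_min hex (by omega)
  rw [hkk, derivedSeries_succ, Subgroup.commutator_eq_bot_iff_le_centralizer] at hk
  set D := derivedSeries H k with hD
  have hDn : D.Normal := derivedSeries_normal H k
  have hcomm : ∀ a ∈ D, ∀ b ∈ D, a * b = b * a := fun a ha b hb =>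
    (Subgroup.mem_centralizer_iff.1 (hk hb) a ha)
  obtain ⟨p, hp, hpd⟩ := Nat.exists_prime_and_dvd (n := Nat.card D)
    ((Subgroup.one_lt_card_iff_ne_bot D).2 hmin).ne'
  have : Fact p.Prime := ⟨hp⟩
  let N : Subgroup H :=
    { carrier := {x | x ∈ D ∧ x ^ p = 1}
      one_mem' := ⟨one_mem _, one_pow _⟩
      mul_mem' := by
        rintro a b ⟨ha, ha'⟩ ⟨hb, hb'⟩
        refine ⟨mul_mem ha hb, ?_⟩
        rw [(show Commute a b from hcomm a ha b hb).mul_pow, ha', hb', one_mul]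
      inv_mem' := by
        rintro a ⟨ha, ha'⟩
        exact ⟨inv_mem ha, by rw [inv_pow, ha', inv_one]⟩ }
  refine ⟨p, N, hp, ⟨?_⟩, ?_, ?_⟩
  · rintro x ⟨hx, hx'⟩ g
    refine ⟨hDn.conj_mem x hx g, ?_⟩
    rw [conj_pow, hx']; simp
  · intro hN
    obtain ⟨x, hx⟩ := exists_prime_orderOf_dvd_card' (G := D) p hpd
    have hxN : (x : H) ∈ N := ⟨x.2, by
      have := pow_orderOf_eq_one x
      rw [hx] at this
      exact_mod_cast congrArg Subtype.val this⟩
    rw [hN, Subgroup.mem_bot] at hxN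
    have : x = 1 := Subtype.ext hxN
    rw [this, orderOf_one] at hx
    exact hp.one_lt.ne hx
  · intro x
    exact ⟨1, by rw [pow_one]; exact Subtype.ext x.2.2⟩

lemma normalClosure_le_of {G : Type*} [Group G] [Finite G] (H K N : Subgroup G) {p : ℕ} (hp : p.Prime)
    (hcop : Nat.Coprime H.index K.index)
    (hN : ∀ h ∈ H, ∀ n ∈ N, h * n * h⁻¹ ∈ N) (hNp : IsPGroup p N)
    (hpK : ¬ p ∣ K.index) : Subgroup.normalClosure (N : Set G) ≤ K := by
  have : Fact p.Prime := ⟨hp⟩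
  rw [Subgroup.index_eq_card] at hpK
  obtain ⟨a, ha⟩ := hNp.nonempty_fixed_point_of_prime_not_dvd_card (G ⧸ K) hpK
  obtain ⟨g, rfl⟩ := QuotientGroup.mk_surjective a
  have h1 : ∀ n ∈ N, g⁻¹ * n * g ∈ K := by
    intro n hn
    have h := ha ⟨n, hn⟩
    have h' : ((n * g : G) : G ⧸ K) = (g : G ⧸ K) := h
    rw [eq_comm, QuotientGroup.eq] at h'
    simpa [mul_assoc] using h'
  obtain ⟨x, hx, y, hy, rfl⟩ := coprime_mul H K hcop g
  have h2 : N ≤ K := by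
    intro n hn
    have h3 := h1 _ (hN x hx n hn)
    have h4 : n = y * ((x * y)⁻¹ * (x * n * x⁻¹) * (x * y)) * y⁻¹ := by group
    rw [h4]
    exact mul_mem (mul_mem hy h3) (inv_mem hy)
  rw [Subgroup.normalClosure, Subgroup.closure_le]
  intro z hz
  rw [Group.mem_conjugatesOfSet_iff] at hz
  obtain ⟨n, hn, hc⟩ := hz
  obtain ⟨c, rfl⟩ := isConj_iff.1 hc
  obtain ⟨a, ha, b, hb, rfl⟩ := coprime_mul K H hcop.symm c
  have : a * b * n * (a * b)⁻¹ = a * (b * n * b⁻¹) * a⁻¹ := by group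
  rw [this]
  exact mul_mem (mul_mem ha (h2 (hN b hb n hn))) (inv_mem ha)

theorem wielandt {G : Type*} [Group G] [Finite G] (H₁ H₂ H₃ : Subgroup G)
    (s₁ : Group.IsSolvable H₁) (s₂ : Group.IsSolvable H₂) (s₃ : Group.IsSolvable H₃)
    (c₁₂ : Nat.Coprime H₁.index H₂.index) (c₁₃ : Nat.Coprime H₁.index H₃.index)
    (c₂₃ : Nat.Coprime H₂.index H₃.index) : Group.IsSolvable G := by
  induction hn : Nat.card G using Nat.strong_induction_on generalizing G with
  | _ n ih =>
  subst hn
  rcases subsingleton_or_nontrivial H₁ with h | h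
  · have hb : H₁ = ⊥ := (Subgroup.eq_bot_iff_forall _).2 fun x hx =>
      congrArg Subtype.val (Subsingleton.elim (⟨x, hx⟩ : H₁) 1)
    rw [hb, Subgroup.index_bot] at c₁₂
    have : H₂.index = 1 := Nat.eq_one_of_dvd_one
      (by rw [← c₁₂]; exact Nat.dvd_gcd (Subgroup.index_dvd_card _) dvd_rfl)
    rw [Subgroup.index_eq_one] at this
    subst this
    exact Group.isSolvable_of_surjective (f := (Subgroup.topEquiv (G := G)).toMonoidHom)
      (Subgroup.topEquiv (G := G)).surjective
  · obtain ⟨p, N₀, hp, hN₀, hne, hpN⟩ := exists_normal_pgroup s₁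
    set N := N₀.map H₁.subtype with hNdef
    have hN : ∀ h ∈ H₁, ∀ n ∈ N, h * n * h⁻¹ ∈ N := by
      rintro h hh _ ⟨n, hn, rfl⟩
      exact ⟨⟨h, hh⟩ * n * ⟨h, hh⟩⁻¹, hN₀.conj_mem n hn _, rfl⟩
    have hNp : IsPGroup p N := hpN.map _
    have hNne : N ≠ ⊥ := by
      rw [hNdef, Ne, Subgroup.map_eq_bot_iff_of_injective _ H₁.subtype_injective]
      exact hne
    have key : Group.IsSolvable (Subgroup.normalClosure (N : Set G)) := by
      by_cases h2 : p ∣ H₂.index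
      · have h3 : ¬ p ∣ H₃.index := fun h3 => by
          have := Nat.dvd_gcd h2 h3
          rw [c₂₃] at this
          exact hp.one_lt.ne' (Nat.dvd_one.1 this)
        have := normalClosure_le_of H₁ H₃ N hp c₁₃ hN hNp h3
        exact Group.isSolvable_of_isSolvable_injective (Subgroup.inclusion_injective this)
      · have := normalClosure_le_of H₁ H₂ N hp c₁₂ hN hNp h2
        exact Group.isSolvable_of_isSolvable_injective (Subgroup.inclusion_injective this)
    set K := Subgroup.normalClosure (N : Set G) with hK
    have hKb : K ≠ ⊥ := fun h => hNne (le_bot_iff.1 (h ▸ Subgroup.le_normalClosure))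
    have h3 := Subgroup.card_mul_index K
    have h4 : 1 < Nat.card K := (Subgroup.one_lt_card_iff_ne_bot K).2 hKb
    have h2 : Nat.card (G ⧸ K) < Nat.card G := by
      rw [← Subgroup.index_eq_card, ← h3]
      have : 0 < K.index := Nat.pos_of_ne_zero Subgroup.index_ne_zero_of_finite
      nlinarith
    have hsurj : Function.Surjective (QuotientGroup.mk' K) := QuotientGroup.mk'_surjective K
    have hd : ∀ H : Subgroup G, (H.map (QuotientGroup.mk' K)).index ∣ H.index := fun H =>
      Subgroup.index_map_dvd H hsurj
    have hsol : ∀ H : Subgroup G, Group.IsSolvable H → Group.IsSolvable (H.map (QuotientGroup.mk' K)) :=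
      fun H hH => Group.isSolvable_of_surjective (MonoidHom.subgroupMap_surjective (QuotientGroup.mk' K) H)
    exact solvable_ext K key (ih _ h2 (H₁.map (QuotientGroup.mk' K)) (H₂.map (QuotientGroup.mk' K))
      (H₃.map (QuotientGroup.mk' K)) (hsol _ s₁) (hsol _ s₂) (hsol _ s₃)
      (Nat.Coprime.of_dvd (hd _) (hd _) c₁₂) (Nat.Coprime.of_dvd (hd _) (hd _) c₁₃)
      (Nat.Coprime.of_dvd (hd _) (hd _) c₂₃) rfl)

/-- the `m`-torsion of an additive commutative group -/
def tors (A : Type*) [AddCommGroup A] (m : ℕ) : AddSubgroup A := (nsmulAddMonoidHom m : A →+ A).ker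

lemma mem_tors {A : Type*} [AddCommGroup A] {m : ℕ} {a : A} : a ∈ tors A m ↔ m • a = 0 := Iff.rfl

lemma coprime_card_of_killed {A : Type*} [AddCommGroup A] [Finite A] (m k : ℕ) (hmk : Nat.Coprime m k)
    (h : ∀ a : A, m • a = 0) : Nat.Coprime (Nat.card A) k := by
  refine Nat.coprime_of_dvd fun r hr hrA hrk => ?_
  have : Fact r.Prime := ⟨hr⟩
  obtain ⟨x, hx⟩ := exists_prime_addOrderOf_dvd_card' (G := A) r hrA
  have h1 : r ∣ m := by rw [← hx]; exact addOrderOf_dvd_of_nsmul_eq_zero (h x)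
  have h2 := Nat.dvd_gcd h1 hrk
  rw [hmk] at h2
  exact hr.one_lt.ne' (Nat.dvd_one.1 h2)

lemma card_tors {A : Type*} [AddCommGroup A] [Finite A] (m k : ℕ) (hmk : Nat.Coprime m k)
    (hA : Nat.card A = m * k) : Nat.card (tors A m) = m := by
  set f : A →+ A := nsmulAddMonoidHom m with hf
  have h1 : Nat.card f.ker * Nat.card f.range = m * k := by
    rw [← hA, ← AddSubgroup.card_mul_index f.ker, AddSubgroup.index_ker]
  have h2 : Nat.Coprime (Nat.card f.ker) k := coprime_card_of_killed m k hmk (fun a =>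
    Subtype.ext a.2)
  have h3 : Nat.Coprime (Nat.card f.range) m := coprime_card_of_killed k m hmk.symm (by
    rintro ⟨_, a, rfl⟩
    apply Subtype.ext
    show k • (m • a) = 0
    rw [← mul_smul, mul_comm, ← hA]
    exact card_nsmul_eq_zero')
  have h4 : Nat.card f.ker ∣ m := h2.dvd_of_dvd_mul_right (h1 ▸ dvd_mul_right _ _)
  have h5 : m ∣ Nat.card f.ker := h3.symm.dvd_of_dvd_mul_right (h1 ▸ dvd_mul_right _ _)
  exact Nat.dvd_antisymm h4 h5

section brace
variable {G A : Type*} [Group G] [AddCommGroup A] (act : G → A →+ A) (c : G → A)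

/-- subgroup attached to the `m`-torsion -/
def torsSub (hc : Function.Bijective c) (hcoc : ∀ g h, c (g * h) = c g + act g (c h)) (m : ℕ) :
    Subgroup G :=
  have h1 : c 1 = 0 := by
    obtain ⟨g, hg⟩ := hc.2 0
    have := hcoc 1 g
    rw [one_mul, hg, map_zero, add_zero] at this
    exact this.symm
  { carrier := {g | m • c g = 0}
    one_mem' := by show m • c 1 = 0; rw [h1, smul_zero]
    mul_mem' := by
      intro a b ha hb
      show m • c (a * b) = 0
      rw [hcoc, smul_add, ← map_nsmul, show m • c a = 0 from ha, show m • c b = 0 from hb, map_zero,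
        add_zero]
    inv_mem' := by
      intro a ha
      show m • c a⁻¹ = 0
      have h2 := hcoc a⁻¹ a
      rw [inv_mul_cancel, h1] at h2
      have h3 : c a⁻¹ = - act a⁻¹ (c a) := eq_neg_of_add_eq_zero_left h2.symm
      rw [h3, smul_neg, ← map_nsmul, show m • c a = 0 from ha, map_zero, neg_zero] }

lemma mem_torsSub (hc : Function.Bijective c) (hcoc : ∀ g h, c (g * h) = c g + act g (c h)) (m : ℕ)
    (g : G) : g ∈ torsSub act c hc hcoc m ↔ m • c g = 0 := Iff.rfl

/-- bijection -/
lemma torsSub_bij (hc : Function.Bijective c) (hcoc : ∀ g h, c (g * h) = c g + act g (c h)) (m : ℕ) :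
    Function.Bijective (fun g : torsSub act c hc hcoc m => (⟨c g, g.2⟩ : tors A m)) := by
  constructor
  · intro a b hab
    exact Subtype.ext (hc.1 (congrArg Subtype.val hab))
  · rintro ⟨a, ha⟩
    obtain ⟨g, rfl⟩ := hc.2 a
    exact ⟨⟨g, ha⟩, rfl⟩

lemma card_torsSub [Finite A] (hc : Function.Bijective c)
    (hcoc : ∀ g h, c (g * h) = c g + act g (c h)) (m k : ℕ)
    (hmk : Nat.Coprime m k) (hA : Nat.card A = m * k) :
    Nat.card (torsSub act c hc hcoc m) = m ∧ (torsSub act c hc hcoc m).index = k := by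
  have h1 : Nat.card (torsSub act c hc hcoc m) = m := by
    rw [Nat.card_eq_of_bijective _ (torsSub_bij act c hc hcoc m), card_tors m k hmk hA]
  refine ⟨h1, ?_⟩
  have h2 := Subgroup.card_mul_index (torsSub act c hc hcoc m)
  rw [h1, Nat.card_eq_of_bijective _ hc, hA] at h2
  have : Nat.card A ≠ 0 := Nat.card_pos.ne'
  have hm : 0 < m := by
    rcases Nat.eq_zero_or_pos m with h | h
    · subst h; simp at hA; omega
    · exact h
  exact Nat.eq_of_mul_eq_mul_left hm h2

end brace

theorem brace_solvable {G A : Type*} [Group G] [AddCommGroup A] [Finite A] (act : G → A →+ A)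
    (c : G → A) (hc : Function.Bijective c) (hcoc : ∀ g h, c (g * h) = c g + act g (c h)) :
    Group.IsSolvable G := by
  classical
  induction hn : Nat.card A using Nat.strong_induction_on generalizing G A with
  | _ n ih =>
  subst hn
  have hfin : Finite G := Finite.of_injective c hc.1
  have hcard : Nat.card G = Nat.card A := Nat.card_eq_of_bijective _ hc
  have hA0 : Nat.card A ≠ 0 := Nat.card_pos.ne'
  have hall : ∀ p, p.Prime → p ∣ Nat.card A → ∃ (H : Subgroup G) (e : ℕ),
      Group.IsSolvable H ∧ H.index = p ^ e := by
    intro p hp hpA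
    obtain ⟨e, m, hpm, hem⟩ := Nat.exists_eq_pow_mul_and_not_dvd hA0 p hp.ne_one
    have hcop : Nat.Coprime m (p ^ e) := (Nat.Coprime.pow_left e ((Nat.Prime.coprime_iff_not_dvd hp).2 hpm)).symm
    have hem' : Nat.card A = m * p ^ e := by rw [hem, mul_comm]
    obtain ⟨h1, h2⟩ := card_torsSub act c hc hcoc m (p ^ e) hcop hem'
    refine ⟨torsSub act c hc hcoc m, e, ?_, h2⟩
    have hlt : Nat.card (tors A m) < Nat.card A := by
      rw [card_tors m (p ^ e) hcop hem']
      refine lt_of_le_of_ne (Nat.le_of_dvd (Nat.pos_of_ne_zero hA0) (hem' ▸ dvd_mul_right _ _)) ?_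
      intro h; rw [h] at hpm; exact hpm hpA
    let act' : torsSub act c hc hcoc m → tors A m →+ tors A m := fun g =>
      ((act g).comp (tors A m).subtype).codRestrict (tors A m) (fun a => by
        show m • act g a = 0
        rw [← map_nsmul, show m • (a : A) = 0 from a.2, map_zero])
    exact ih _ hlt act' _ (torsSub_bij act c hc hcoc m) (fun g h => Subtype.ext (hcoc g h)) rfl
  by_cases h3 : ∃ p q r : ℕ, p.Prime ∧ q.Prime ∧ r.Prime ∧ p ∣ Nat.card A ∧ q ∣ Nat.card A ∧
      r ∣ Nat.card A ∧ p ≠ q ∧ p ≠ r ∧ q ≠ r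
  · obtain ⟨p, q, r, hp, hq, hr, hpA, hqA, hrA, hpq, hpr, hqr⟩ := h3
    obtain ⟨H₁, e₁, s₁, i₁⟩ := hall p hp hpA
    obtain ⟨H₂, e₂, s₂, i₂⟩ := hall q hq hqA
    obtain ⟨H₃, e₃, s₃, i₃⟩ := hall r hr hrA
    refine wielandt H₁ H₂ H₃ s₁ s₂ s₃ ?_ ?_ ?_
    · rw [i₁, i₂]; exact Nat.coprime_pow_primes _ _ hp hq hpq
    · rw [i₁, i₃]; exact Nat.coprime_pow_primes _ _ hp hr hpr
    · rw [i₂, i₃]; exact Nat.coprime_pow_primes _ _ hq hr hqr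
  · by_cases h1 : ∃ p, p.Prime ∧ p ∣ Nat.card A
    · obtain ⟨p, hp, hpA⟩ := h1
      by_cases h2 : ∃ q, q.Prime ∧ q ∣ Nat.card A ∧ p ≠ q
      · obtain ⟨q, hq, hqA, hpq⟩ := h2
        refine paqb p q hp hq fun r hr hrG => ?_
        by_contra hcon
        push Not at hcon
        exact h3 ⟨p, q, r, hp, hq, hr, hpA, hqA, hcard ▸ hrG, hpq, hcon.1.symm, hcon.2.symm⟩
      · refine paqb p p hp hp fun r hr hrG => ?_
        by_contra hcon
        push Not at hcon
        exact h2 ⟨r, hr, hcard ▸ hrG, hcon.1.symm⟩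
    · refine paqb 2 2 Nat.prime_two Nat.prime_two fun r hr hrG => ?_
      exact absurd ⟨r, hr, hcard ▸ hrG⟩ h1

theorem coatom_index {G : Type*} [Group G] [Finite G] (hs : Group.IsSolvable G) (M : Subgroup G)
    (hM : IsCoatom M) : ∃ p k : ℕ, p.Prime ∧ M.index = p ^ k := by
  classical
  obtain ⟨n, hn⟩ := hs.solvable
  have hex : ∃ n, derivedSeries G n ≤ M := ⟨n, hn ▸ bot_le⟩
  have hk := Nat.find_spec hex
  have hk0 : Nat.find hex ≠ 0 := by
    intro h0
    rw [h0, derivedSeries_zero] at hk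
    exact hM.1 (top_le_iff.1 hk)
  obtain ⟨k, hkk⟩ := Nat.exists_eq_succ_of_ne_zero hk0
  have hmin : ¬ derivedSeries G k ≤ M := Nat.find_min hex (by omega)
  rw [hkk, derivedSeries_succ] at hk
  set K := derivedSeries G k with hK
  have hKn : K.Normal := derivedSeries_normal G k
  have hcommM : ∀ a ∈ K, ∀ b ∈ K, a * b * a⁻¹ * b⁻¹ ∈ M := fun a ha b hb =>
    hk (Subgroup.commutator_mem_commutator ha hb)
  have htop : ∀ L : Subgroup G, ¬ L ≤ M → M ⊔ L = ⊤ := fun L hL =>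
    hM.2 _ (lt_of_le_of_ne le_sup_left fun h => hL (h ▸ le_sup_right))
  have hMK := htop K hmin
  have hRn : (M ⊓ K).Normal := by
    constructor
    intro x hx g
    have hg : g ∈ M ⊔ K := by rw [hMK]; trivial
    rw [← SetLike.mem_coe, Subgroup.mul_normal] at hg
    obtain ⟨m, hm, y, hy, rfl⟩ := hg
    refine ⟨?_, hKn.conj_mem x hx.2 _⟩
    have h1 : (m * y) * x * (m * y)⁻¹ = m * ((y * x * y⁻¹ * x⁻¹) * x) * m⁻¹ := by group
    show (m * y) * x * (m * y)⁻¹ ∈ M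
    rw [h1]
    exact mul_mem (mul_mem hm (mul_mem (hcommM y hy x hx.2) hx.1)) (inv_mem hm)
  have hidx : M.index = M.relIndex K := by
    have e1 := Subgroup.relIndex_mul_index (show M ⊓ K ≤ K from inf_le_right)
    have e2 := Subgroup.relIndex_mul_index (show M ⊓ K ≤ M from inf_le_left)
    have e3 : K.relIndex M = K.index := by
      rw [← Subgroup.relIndex_sup_right, hMK, Subgroup.relIndex_top_right]
    rw [Subgroup.inf_relIndex_right] at e1
    rw [Subgroup.inf_relIndex_left, e3] at e2
    have e4 : K.index ≠ 0 := Subgroup.index_ne_zero_of_finite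
    apply Nat.eq_of_mul_eq_mul_right (Nat.pos_of_ne_zero e4)
    rw [e1, ← e2, mul_comm]
  have hne1 : M.relIndex K ≠ 1 := by
    rw [Ne, Subgroup.relIndex_eq_one]; exact hmin
  obtain ⟨p, hp, hpd⟩ := Nat.exists_prime_and_dvd hne1
  have : Fact p.Prime := ⟨hp⟩
  have hRn' : (M.subgroupOf K).Normal := by
    rw [← Subgroup.inf_subgroupOf_right]
    infer_instance
  have hQcomm : ∀ a b : K ⧸ M.subgroupOf K, a * b = b * a := by
    intro a b
    obtain ⟨a, rfl⟩ := QuotientGroup.mk_surjective a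
    obtain ⟨b, rfl⟩ := QuotientGroup.mk_surjective b
    rw [← QuotientGroup.mk_mul, ← QuotientGroup.mk_mul, QuotientGroup.eq, Subgroup.mem_subgroupOf]
    have := hcommM _ (inv_mem b.2) _ (inv_mem a.2)
    simpa [mul_assoc] using this
  let L : Subgroup G :=
    { carrier := {x | x ∈ K ∧ x ^ p ∈ M}
      one_mem' := ⟨one_mem _, by rw [one_pow]; exact one_mem _⟩
      mul_mem' := by
        rintro a b ⟨ha, ha'⟩ ⟨hb, hb'⟩
        refine ⟨mul_mem ha hb, ?_⟩
        have h1 : ((⟨a, ha⟩ * ⟨b, hb⟩ : K) : K ⧸ M.subgroupOf K) ^ p = 1 := by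
          rw [QuotientGroup.mk_mul, (show Commute _ _ from hQcomm _ _).mul_pow, ← QuotientGroup.mk_pow,
            ← QuotientGroup.mk_pow, (QuotientGroup.eq_one_iff _).2 (show (⟨a, ha⟩ : K) ^ p ∈ M.subgroupOf K from ha'),
            (QuotientGroup.eq_one_iff _).2 (show (⟨b, hb⟩ : K) ^ p ∈ M.subgroupOf K from hb'), one_mul]
        rw [← QuotientGroup.mk_pow, QuotientGroup.eq_one_iff] at h1
        exact h1
      inv_mem' := by
        rintro a ⟨ha, ha'⟩
        exact ⟨inv_mem ha, by rw [inv_pow]; exact inv_mem ha'⟩ }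
  have hLn : L.Normal := by
    constructor
    rintro x ⟨hx, hx'⟩ g
    refine ⟨hKn.conj_mem x hx g, ?_⟩
    rw [conj_pow]
    exact (hRn.conj_mem (x ^ p) ⟨hx', pow_mem hx p⟩ g).1
  have hLM : ¬ L ≤ M := by
    intro hle
    have hpd' : p ∣ Nat.card (K ⧸ M.subgroupOf K) := hpd
    obtain ⟨x, hx⟩ := exists_prime_orderOf_dvd_card' (G := K ⧸ M.subgroupOf K) p hpd'
    obtain ⟨x, rfl⟩ := QuotientGroup.mk_surjective x
    have h1 := pow_orderOf_eq_one (x : K ⧸ M.subgroupOf K)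
    rw [hx, ← QuotientGroup.mk_pow, QuotientGroup.eq_one_iff] at h1
    have h2 : (x : G) ∈ M := hle ⟨x.2, h1⟩
    have h3 : (x : K ⧸ M.subgroupOf K) = 1 := (QuotientGroup.eq_one_iff _).2 h2
    rw [h3, orderOf_one] at hx
    exact hp.one_lt.ne hx
  have hKL : ∀ x ∈ K, x ^ p ∈ M := by
    intro x hx
    have hg : x ∈ M ⊔ L := by rw [htop L hLM]; trivial
    rw [← SetLike.mem_coe, Subgroup.mul_normal] at hg
    obtain ⟨m, hm, y, hy, rfl⟩ := hg
    have hmK : m ∈ K := by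
      have := mul_mem hx (inv_mem hy.1)
      simpa using this
    exact (mul_mem (show m ∈ L from ⟨hmK, pow_mem hm p⟩) hy).2
  have hpg : IsPGroup p (K ⧸ M.subgroupOf K) := by
    intro x
    obtain ⟨x, rfl⟩ := QuotientGroup.mk_surjective x
    refine ⟨1, ?_⟩
    rw [pow_one, ← QuotientGroup.mk_pow, QuotientGroup.eq_one_iff]
    exact hKL x x.2
  obtain ⟨j, hj⟩ := IsPGroup.iff_card.1 hpg
  exact ⟨p, j, hp, by rw [hidx]; exact hj⟩

lemma perm_apply_inv {X : Type*} (g : Equiv.Perm X) (x : X) : g (g⁻¹ x) = x := by simp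

section cocycle
variable {X : Type*} (lam : X → Equiv.Perm X)

/-- graph of the structure cocycle -/
inductive CocRel : Multiset X → Equiv.Perm X → Prop
  | zero : CocRel 0 1
  | step (a : Multiset X) (g : Equiv.Perm X) (y : X) (h : CocRel a g) :
      CocRel (g y ::ₘ a) (g * lam y)

lemma CocRel.exists (a : Multiset X) : ∃ g, CocRel lam a g := by
  induction a using Multiset.induction_on with
  | empty => exact ⟨1, .zero⟩
  | cons x a ih =>
    obtain ⟨g, hg⟩ := ih
    have := CocRel.step a g (g⁻¹ x) hg
    rw [perm_apply_inv] at this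
    exact ⟨_, this⟩

lemma CocRel.unique (hl : ∀ x z, lam x * lam ((lam x)⁻¹ z) = lam z * lam ((lam z)⁻¹ x)) :
    ∀ (n : ℕ) (a : Multiset X) (g g' : Equiv.Perm X), Multiset.card a = n → CocRel lam a g →
      CocRel lam a g' → g = g' := by
  classical
  intro n
  induction n with
  | zero =>
    intro a g g' ha hg hg'
    cases hg with
    | zero =>
      generalize hb : (0 : Multiset X) = b at hg'
      cases hg' with
      | zero => rfl
      | step => simp at hb
    | step => simp at ha
  | succ n ih =>
    intro a g g' ha hg hg'
    cases hg with
    | zero => simp at ha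
    | step a g y h =>
      generalize hb : g y ::ₘ a = b at hg'
      cases hg' with
      | zero => simp at hb
      | step b k z h' =>
        rw [Multiset.card_cons] at ha
        have ha' : Multiset.card a = n := by omega
        rw [Multiset.cons_eq_cons] at hb
        rcases hb with ⟨h1, rfl⟩ | ⟨hne, c, h1, h2⟩
        · obtain rfl := ih a g k ha' h h'
          rw [g.injective h1]
        · obtain ⟨w, hw⟩ := CocRel.exists lam c
          have s1 := CocRel.step c w (w⁻¹ (k z)) hw
          have s2 := CocRel.step c w (w⁻¹ (g y)) hw
          rw [perm_apply_inv] at s1 s2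
          have hb' : Multiset.card b = n := by
            rw [h2, Multiset.card_cons, ← ha', h1, Multiset.card_cons]
          have e1 := ih a g _ ha' h (h1 ▸ s1)
          have e2 := ih b k _ hb' h' (h2 ▸ s2)
          have f1 : y = (lam (w⁻¹ (k z)))⁻¹ (w⁻¹ (g y)) := by
            rw [Equiv.Perm.eq_inv_iff_eq, Equiv.Perm.eq_inv_iff_eq, ← Equiv.Perm.mul_apply, ← e1]
          have f2 : z = (lam (w⁻¹ (g y)))⁻¹ (w⁻¹ (k z)) := by
            rw [Equiv.Perm.eq_inv_iff_eq, Equiv.Perm.eq_inv_iff_eq, ← Equiv.Perm.mul_apply, ← e2]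
          generalize w⁻¹ (k z) = u at *
          generalize w⁻¹ (g y) = v at *
          rw [e1, e2, f1, f2, mul_assoc, mul_assoc, hl]

/-- the cocycle on multisets -/
noncomputable def Coc (a : Multiset X) : Equiv.Perm X := (CocRel.exists lam a).choose

variable {lam}

lemma Coc_eq (hl : ∀ x z, lam x * lam ((lam x)⁻¹ z) = lam z * lam ((lam z)⁻¹ x))
    {a : Multiset X} {g : Equiv.Perm X} (h : CocRel lam a g) : Coc lam a = g :=
  CocRel.unique lam hl _ a _ _ rfl (CocRel.exists lam a).choose_spec h

lemma Coc_zero (hl : ∀ x z, lam x * lam ((lam x)⁻¹ z) = lam z * lam ((lam z)⁻¹ x))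
    : Coc lam 0 = 1 := Coc_eq hl .zero

lemma Coc_cons (hl : ∀ x z, lam x * lam ((lam x)⁻¹ z) = lam z * lam ((lam z)⁻¹ x))
    (a : Multiset X) (y : X) : Coc lam (Coc lam a y ::ₘ a) = Coc lam a * lam y :=
  Coc_eq hl (.step a _ y (CocRel.exists lam a).choose_spec)

lemma Coc_add (hl : ∀ x z, lam x * lam ((lam x)⁻¹ z) = lam z * lam ((lam z)⁻¹ x))
    (a b : Multiset X) : Coc lam (a + b.map (Coc lam a)) = Coc lam a * Coc lam b := by
  induction b using Multiset.induction_on with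
  | empty => simp [Coc_zero hl]
  | cons z b ih =>
    have hz : z = Coc lam b ((Coc lam b)⁻¹ z) := by simp
    generalize (Coc lam b)⁻¹ z = y at hz
    subst hz
    rw [Coc_cons hl, Multiset.map_cons, Multiset.add_cons, ← Equiv.Perm.mul_apply, ← ih,
      Coc_cons hl, ih, mul_assoc]

lemma Coc_replicate (hl : ∀ x z, lam x * lam ((lam x)⁻¹ z) = lam z * lam ((lam z)⁻¹ x))
    (hsf : ∀ x, lam x x = x) (k : ℕ) (y : X) :
    Coc lam (Multiset.replicate k y) = lam y ^ k := by
  induction k with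
  | zero => simp [Coc_zero hl]
  | succ k ih =>
    have h1 : Coc lam (Multiset.replicate k y) y = y := by
      rw [ih]
      exact Function.IsFixedPt.perm_pow (hsf y) k
    have h2 := Coc_cons hl (Multiset.replicate k y) y
    rw [h1, ih] at h2
    rw [Multiset.replicate_succ, h2, pow_succ]

lemma Coc_add_replicate (hl : ∀ x z, lam x * lam ((lam x)⁻¹ z) = lam z * lam ((lam z)⁻¹ x))
    (hsf : ∀ x, lam x x = x) (d : ℕ) (hd : ∀ x, lam x ^ d = 1)
    (a : Multiset X) (y : X) :
    Coc lam (a + Multiset.replicate d y) = Coc lam a := by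
  have h := Coc_add hl a (Multiset.replicate d ((Coc lam a)⁻¹ y))
  rw [Multiset.map_replicate, Coc_replicate hl hsf, hd, mul_one, perm_apply_inv] at h
  exact h

lemma Coc_add_nsmul (hl : ∀ x z, lam x * lam ((lam x)⁻¹ z) = lam z * lam ((lam z)⁻¹ x))
    (hsf : ∀ x, lam x x = x) (d : ℕ) (hd : ∀ x, lam x ^ d = 1)
    (a b : Multiset X) :
    Coc lam (a + d • b) = Coc lam a := by
  induction b using Multiset.induction_on with
  | empty => simp
  | cons y b ih =>
    rw [← Multiset.singleton_add, nsmul_add, Multiset.nsmul_singleton,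
      add_comm (Multiset.replicate d y), ← add_assoc, Coc_add_replicate hl hsf d hd, ih]

end cocycle

/-- permutation action on functions -/
def permAct {G X B : Type*} [Group G] [MulAction G X] [AddCommGroup B] (g : G) :
    (X → B) →+ (X → B) where
  toFun b := fun x => b (g⁻¹ • x)
  map_zero' := rfl
  map_add' _ _ := rfl

theorem rump_abstract {G X : Type*} [Group G] [Finite X] [MulAction G X] (d : ℕ) [NeZero d]
    (c : G → (X → ZMod d)) (hc : Function.Bijective c)
    (hcoc : ∀ g h, c (g * h) = c g + permAct g (c h))
    [DecidableEq X]
    (hsf : ∀ (g : G) (k : ℕ) (y : X), c g = k • Pi.single y 1 → g • y = y)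
    (htr : ∀ x y : X, ∃ g : G, g • x = y) : Subsingleton X := by
  classical
  by_contra hns
  rw [not_subsingleton_iff_nontrivial] at hns
  obtain ⟨x, x', hxx⟩ := hns
  have hGfin : Finite G := Finite.of_injective c hc.1
  have hcard : Nat.card G = Nat.card (X → ZMod d) := Nat.card_eq_of_bijective _ hc
  have hs := brace_solvable permAct c hc hcoc
  have hst : MulAction.stabilizer G x ≠ ⊤ := by
    intro h
    obtain ⟨g, hg⟩ := htr x x'
    have : g ∈ MulAction.stabilizer G x := h ▸ Subgroup.mem_top g
    rw [MulAction.mem_stabilizer_iff] at this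
    exact hxx (this.symm.trans hg)
  obtain ⟨M, hM, hxM⟩ := (eq_top_or_exists_le_coatom (MulAction.stabilizer G x)).resolve_left hst
  obtain ⟨p, j, hp, hpj⟩ := coatom_index hs M hM
  have hfp : Fact p.Prime := ⟨hp⟩
  have hA0 : Nat.card (X → ZMod d) ≠ 0 := Nat.card_pos.ne'
  obtain ⟨E, m, hpm, hem⟩ := Nat.exists_eq_pow_mul_and_not_dvd hA0 p hp.ne_one
  have hcop0 : Nat.Coprime p m := (Nat.Prime.coprime_iff_not_dvd hp).2 hpm
  have hcop : Nat.Coprime (p ^ E) m := Nat.Coprime.pow_left E hcop0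
  obtain ⟨hPc, hPi⟩ := card_torsSub permAct c hc hcoc (p ^ E) m hcop hem
  set P := torsSub permAct c hc hcoc (p ^ E) with hP
  have hmemP : ∀ g, g ∈ P ↔ p ^ E • c g = 0 := fun g => Iff.rfl
  have hPM : ∀ g : G, ∃ a ∈ P, ∃ b ∈ M, g = a * b := coprime_mul P M (by
    rw [hPi, hpj]; exact (Nat.Coprime.pow_left j hcop0).symm)
  have hMP : M.subgroupOf P ≠ ⊤ := by
    intro h
    rw [Subgroup.subgroupOf_eq_top] at h
    apply hM.1
    rw [Subgroup.eq_top_iff']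
    intro g
    obtain ⟨a, ha, b, hb, rfl⟩ := hPM g
    exact mul_mem (h ha) hb
  obtain ⟨N, hN, hMN⟩ := (eq_top_or_exists_le_coatom (M.subgroupOf P)).resolve_left hMP
  have hPp : IsPGroup p P := IsPGroup.of_card hPc
  have hnil : Group.IsNilpotent P := hPp.isNilpotent
  have hNn : N.Normal := Subgroup.NormalizerCondition.normal_of_coatom N Group.normalizerCondition_of_isNilpotent hN
  have hzero : ∀ a : X → ZMod d, p ^ E • (m • a) = 0 := by
    intro a
    rw [← mul_smul, ← hem]
    exact card_nsmul_eq_zero'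
  have hkey : ∀ (g : P) (y : X), c g = m • Pi.single y 1 → g ∈ N := by
    intro t y ht
    have hfix := hsf t m y ht
    obtain ⟨g, hg⟩ := htr x y
    obtain ⟨h, hh, b, hb, rfl⟩ := hPM g
    have h1 : h⁻¹ * t * h ∈ M := by
      have h2 : b⁻¹ * (h⁻¹ * t * h) * b ∈ M := by
        apply hxM
        rw [MulAction.mem_stabilizer_iff]
        have : b⁻¹ * (h⁻¹ * t * h) * b = (h * b)⁻¹ * (t * (h * b)) := by group
        rw [this, mul_smul, mul_smul, hg, hfix, ← hg, inv_smul_smul]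
      have := mul_mem (mul_mem hb h2) (inv_mem hb)
      simpa [mul_assoc] using this
    let h' : P := ⟨h, hh⟩
    have h3 : h'⁻¹ * t * h' ∈ N := hMN h1
    have := hNn.conj_mem _ h3 h'
    simpa [mul_assoc] using this
  have hcl : ∀ (s : Multiset X), ∃ n ∈ N, c (n : P) = (s.map fun y => m • (Pi.single y 1 : X → ZMod d)).sum := by
    intro s
    induction s using Multiset.induction_on with
    | empty =>
      refine ⟨1, one_mem _, ?_⟩
      have := hcoc 1 1
      rw [one_mul] at this
      have h0 : permAct (1 : G) (c 1) = c 1 := by funext z; simp [permAct]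
      rw [h0] at this
      simpa using this
    | cons y s ih =>
      obtain ⟨n, hn, hcn⟩ := ih
      obtain ⟨t, ht⟩ := hc.2 (m • Pi.single ((n : G)⁻¹ • y) 1)
      have htP : t ∈ P := by rw [hmemP, ht]; exact hzero _
      refine ⟨n * ⟨t, htP⟩, mul_mem hn (hkey _ _ ht), ?_⟩
      rw [Subgroup.coe_mul, hcoc, hcn, Multiset.map_cons, Multiset.sum_cons, add_comm]
      congr 1
      show permAct (n : G) (c t) = _
      rw [ht, map_nsmul]
      congr 1
      funext z
      simp only [permAct, AddMonoidHom.coe_mk, ZeroHom.coe_mk, Pi.single_apply]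
      simp
  apply hN.1
  rw [Subgroup.eq_top_iff']
  intro g
  have := Fintype.ofFinite X
  obtain ⟨u, hu1, hu2⟩ := Nat.chineseRemainder hcop 1 0
  obtain ⟨v, rfl⟩ := (Nat.modEq_zero_iff_dvd).1 hu2
  have hga : (m * v) • c g = c g := by
    have h1 : addOrderOf (c (g : G)) ∣ p ^ E := addOrderOf_dvd_of_nsmul_eq_zero g.2
    have := (nsmul_eq_nsmul_iff_modEq (x := c (g : G))).2 (hu1.of_dvd h1)
    rwa [one_nsmul] at this
  obtain ⟨n, hn, hcn⟩ := hcl (∑ z, Multiset.replicate (v * (c g z).val) z)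
  have hsum : ((∑ z, Multiset.replicate (v * (c g z).val) z).map
      fun y => m • (Pi.single y 1 : X → ZMod d)).sum = c g := by
    have h1 := map_sum ((Multiset.sumAddMonoidHom).comp (Multiset.mapAddMonoidHom
      fun y => m • (Pi.single y 1 : X → ZMod d))) (fun z => Multiset.replicate (v * (c g z).val) z)
      Finset.univ
    simp only [AddMonoidHom.comp_apply, Multiset.coe_sumAddMonoidHom,
      Multiset.coe_mapAddMonoidHom, Multiset.map_replicate, Multiset.sum_replicate] at h1
    rw [h1]
    conv_rhs => rw [← hga]
    funext w
    rw [Finset.sum_apply, Finset.sum_eq_single w]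
    · simp
      ring
    · intro b _ hb
      simp [Pi.single_apply, hb.symm]
    · simp
  rw [hsum] at hcn
  have : n = g := Subtype.ext (hc.1 hcn)
  exact this ▸ hn

section modcocycle

/-- class of a multiset modulo `d` -/
def mclass {X : Type*} [DecidableEq X] (d : ℕ) (s : Multiset X) : X → ZMod d :=
  fun x => (s.count x : ZMod d)

lemma mclass_add {X : Type*} [DecidableEq X] (d : ℕ) (s t : Multiset X) :
    mclass d (s + t) = mclass d s + mclass d t := by
  funext x; simp [mclass]

lemma mclass_map {X : Type*} [DecidableEq X] (d : ℕ) (s : Multiset X) (g : Equiv.Perm X) :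
    mclass d (s.map g) = fun x => mclass d s (g⁻¹ x) := by
  funext x
  have h := Multiset.count_map_eq_count' g s g.injective (g⁻¹ x)
  rw [perm_apply_inv] at h
  simp only [mclass, h]

lemma mclass_surj {X : Type*} [DecidableEq X] [Fintype X] (d : ℕ) [NeZero d] (a : X → ZMod d) :
    ∃ s, mclass d s = a := by
  refine ⟨∑ z, Multiset.replicate (a z).val z, ?_⟩
  funext x
  simp only [mclass, Multiset.count_sum', Multiset.count_replicate]
  simp

lemma exists_nsmul_of_mclass {X : Type*} [DecidableEq X] [Fintype X] (d : ℕ) (s : Multiset X)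
    (h : mclass d s = 0) : ∃ w : Multiset X, s = d • w := by
  refine ⟨∑ z, Multiset.replicate (s.count z / d) z, ?_⟩
  ext x
  have hx : d ∣ s.count x := by
    rw [← ZMod.natCast_eq_zero_iff]
    exact congrFun h x
  rw [Multiset.count_nsmul, Multiset.count_sum']
  simp only [Multiset.count_replicate]
  simp [Nat.mul_div_cancel' hx]

lemma Coc_congr {X : Type*} [DecidableEq X] [Fintype X] {lam : X → Equiv.Perm X}
    (hl : ∀ x z, lam x * lam ((lam x)⁻¹ z) = lam z * lam ((lam z)⁻¹ x))
    (hsf : ∀ x, lam x x = x) (d : ℕ) (hd0 : 0 < d) (hd : ∀ x, lam x ^ d = 1) (s t : Multiset X)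
    (hst : mclass d s = mclass d t) : Coc lam s = Coc lam t := by
  obtain ⟨e, rfl⟩ : ∃ e, d = e + 1 := ⟨d - 1, by omega⟩
  have h0 : mclass (e + 1) (s + e • t) = 0 := by
    rw [mclass_add, hst]
    funext x
    simp only [mclass, Pi.add_apply, Multiset.count_nsmul, Pi.zero_apply]
    have : ((t.count x + e * t.count x : ℕ) : ZMod (e + 1)) = 0 := by
      rw [ZMod.natCast_eq_zero_iff]
      exact ⟨t.count x, by ring⟩
    exact_mod_cast this
  obtain ⟨w, hw⟩ := exists_nsmul_of_mclass (e + 1) _ h0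
  rw [← Coc_add_nsmul hl hsf (e + 1) hd s t, ← Coc_add_nsmul hl hsf (e + 1) hd t w, ← hw,
    succ_nsmul]
  congr 1
  rw [add_comm t, add_assoc]

end modcocycle

/-- wrapper for the multiplicative group of the brace -/
structure BGrp (X : Type*) (d : ℕ) (_L : (X → ZMod d) → Equiv.Perm X) where
  /-- underlying vector -/
  val : X → ZMod d

theorem rump {X : Type*} [Finite X] (lam : X → Equiv.Perm X)
    (hl : ∀ x z, lam x * lam ((lam x)⁻¹ z) = lam z * lam ((lam z)⁻¹ x))
    (hsf : ∀ x, lam x x = x)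
    (htr : ∀ a b : X, ∃ g ∈ Subgroup.closure (Set.range lam), g a = b) : Subsingleton X := by
  classical
  have := Fintype.ofFinite X
  obtain ⟨d, hd0, hd⟩ : ∃ d : ℕ, 0 < d ∧ ∀ g : Equiv.Perm X, g ^ d = 1 :=
    ⟨Fintype.card (Equiv.Perm X), Fintype.card_pos, fun g => pow_card_eq_one⟩
  have : NeZero d := ⟨hd0.ne'⟩
  choose rep hrep using mclass_surj (X := X) d
  let L : (X → ZMod d) → Equiv.Perm X := fun a => Coc lam (rep a)
  have hL : ∀ s, L (mclass d s) = Coc lam s := fun s =>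
    Coc_congr hl hsf d hd0 (fun x => hd _) _ _ (hrep _)
  have hLmul : ∀ a b : X → ZMod d, L (a + fun x => b ((L a)⁻¹ x)) = L a * L b := by
    intro a b
    obtain ⟨s, rfl⟩ := mclass_surj d a
    obtain ⟨t, rfl⟩ := mclass_surj d b
    rw [hL, hL, ← Coc_add hl, ← mclass_map, ← mclass_add, hL]
  have hL0 : L 0 = 1 := by
    have h0 : mclass d (0 : Multiset X) = 0 := by funext x; simp [mclass]
    rw [← h0, hL, Coc_zero hl]
  let _ : Mul (BGrp X d L) := ⟨fun a b => ⟨a.val + fun x => b.val ((L a.val)⁻¹ x)⟩⟩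
  let _ : One (BGrp X d L) := ⟨⟨0⟩⟩
  let _ : Inv (BGrp X d L) := ⟨fun a => ⟨fun x => - a.val (L a.val x)⟩⟩
  have hmul : ∀ a b : BGrp X d L, (a * b).val = a.val + fun x => b.val ((L a.val)⁻¹ x) :=
    fun _ _ => rfl
  have hLm : ∀ a b : BGrp X d L, L (a * b).val = L a.val * L b.val := fun a b => hLmul _ _
  have hext : ∀ a b : BGrp X d L, a.val = b.val → a = b := by
    rintro ⟨a⟩ ⟨b⟩ h; exact congrArg _ h
  letI : Group (BGrp X d L) := Group.ofRightAxioms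
    (by
      intro a b e
      apply hext
      rw [hmul, hLm, hmul, hmul, hmul]
      funext x
      simp [add_assoc])
    (by
      intro a
      apply hext
      rw [hmul]
      funext x
      show a.val x + 0 = a.val x
      rw [add_zero])
    (by
      intro a
      apply hext
      rw [hmul]
      funext x
      show a.val x + - a.val (L a.val ((L a.val)⁻¹ x)) = 0
      rw [perm_apply_inv, add_neg_cancel])
  let φ : BGrp X d L →* Equiv.Perm X := 
    { toFun := fun a => L a.val
      map_one' := hL0
      map_mul' := hLm }
  letI : MulAction (BGrp X d L) X := MulAction.compHom X φ
  have hsm : ∀ (g : BGrp X d L) (x : X), g • x = L g.val x := fun _ _ => rfl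
  refine rump_abstract (G := BGrp X d L) d (fun a => a.val) ⟨hext, fun a => ⟨⟨a⟩, rfl⟩⟩ ?_ ?_ ?_
  · intro g h
    show (g * h).val = _
    rw [hmul]
    congr 1
    funext x
    show _ = h.val (L (g⁻¹).val x)
    have : L (g⁻¹).val = (L g.val)⁻¹ := map_inv φ g
    rw [this]
  · intro g k y h
    have h : g.val = mclass d (Multiset.replicate k y) := by
      rw [show g.val = _ from h]
      funext x
      simp only [mclass, Multiset.count_replicate, Pi.smul_apply, Pi.single_apply]
      by_cases hxy : x = y
      · subst hxy; simp
      · simp [hxy, Ne.symm hxy]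
    rw [hsm, h, hL, Coc_replicate hl hsf]
    exact Function.IsFixedPt.perm_pow (hsf y) k
  · intro x y
    obtain ⟨g, hg, rfl⟩ := htr x y
    have hle : Subgroup.closure (Set.range lam) ≤ φ.range := by
      rw [Subgroup.closure_le]
      rintro _ ⟨z, rfl⟩
      refine ⟨⟨mclass d (Multiset.replicate 1 z)⟩, ?_⟩
      show L _ = _
      rw [hL, Coc_replicate hl hsf, pow_one]
    obtain ⟨a, rfl⟩ := hle hg
    exact ⟨a, rfl⟩

theorem rump_cycle_set {Y : Type*} [Finite Y] (op : Y → Y → Y)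
    (hbij : ∀ x, Function.Bijective (op x))
    (hcyc : ∀ x y z, op (op x y) (op x z) = op (op y x) (op y z))
    (hsf : ∀ y, op y y = y)
    (hind : ∀ a b : Y, ∃ g ∈ Subgroup.closure
      (Set.range fun x => Equiv.ofBijective (op x) (hbij x)), g a = b) : Subsingleton Y := by
  let s : Y → Equiv.Perm Y := fun y => Equiv.ofBijective (op y) (hbij y)
  have hs : ∀ x y, s x y = op x y := fun _ _ => rfl
  have hc : ∀ x y, s (op x y) * s x = s (op y x) * s y := fun x y => Equiv.ext fun z => hcyc x y z
  refine rump (fun y => (s y)⁻¹) ?_ ?_ ?_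
  · intro x z
    simp only [inv_inv, hs]
    rw [← mul_inv_rev, ← mul_inv_rev, hc]
  · intro x
    show (s x)⁻¹ x = x
    rw [Equiv.Perm.inv_eq_iff_eq, hs, hsf]
  · intro a b
    obtain ⟨g, hg, h⟩ := hind a b
    refine ⟨g, ?_, h⟩
    refine (Subgroup.closure_le _).2 ?_ hg
    rintro _ ⟨y, rfl⟩
    rw [SetLike.mem_coe, ← Subgroup.inv_mem_iff]
    exact Subgroup.subset_closure ⟨y, rfl⟩

/-- A finite indecomposable non-degenerate cycle set whose squaring map
is a `p`-cycle (`p` prime) is simple: every epimorphism onto a cycle set is an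
isomorphism or has one-element image. -/
theorem stmt11 {X : Type u} [Fintype X] [DecidableEq X] (op : X → X → X)
    (hbij : ∀ x, Function.Bijective (op x))
    (hcyc : ∀ x y z, op (op x y) (op x z) = op (op y x) (op y z))
    (hT : Function.Bijective fun x => op x x)
    (p : ℕ) (hp : p.Prime)
    (hcycleT : Equiv.Perm.IsCycle (Equiv.ofBijective _ hT) ∧
      (Equiv.Perm.support (Equiv.ofBijective _ hT)).card = p)
    (hind : ∀ a b : X, ∃ g ∈ Subgroup.closure
      (Set.range fun x => Equiv.ofBijective (op x) (hbij x)), g a = b) :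
    ∀ (Y : Type u) (opY : Y → Y → Y),
      (∀ y, Function.Bijective (opY y)) →
      (∀ a b c : Y, opY (opY a b) (opY a c) = opY (opY b a) (opY b c)) →
      ∀ f : X → Y, Function.Surjective f →
        (∀ a b, f (op a b) = opY (f a) (f b)) →
        Function.Bijective f ∨ Nat.card Y = 1 := by
  intro Y opY hbY hcY f hf hom
  have hYfin : Finite Y := Finite.of_surjective f hf
  have hlift : ∀ g ∈ Subgroup.closure (Set.range fun x => Equiv.ofBijective (op x) (hbij x)),
      ∃ k ∈ Subgroup.closure (Set.range fun y => Equiv.ofBijective (opY y) (hbY y)),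
        ∀ a, f (g a) = k (f a) := by
    intro g hg
    induction hg using Subgroup.closure_induction with
    | mem g hg =>
      obtain ⟨x, rfl⟩ := hg
      exact ⟨_, Subgroup.subset_closure ⟨f x, rfl⟩, fun a => hom x a⟩
    | one => exact ⟨1, one_mem _, fun a => rfl⟩
    | mul g h _ _ ihg ihh =>
      obtain ⟨k, hk, hk'⟩ := ihg
      obtain ⟨l, hl, hl'⟩ := ihh
      exact ⟨k * l, mul_mem hk hl, fun a => by
        rw [Equiv.Perm.mul_apply, hk', hl', Equiv.Perm.mul_apply]⟩
    | inv g _ ih =>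
      obtain ⟨k, hk, hk'⟩ := ih
      refine ⟨k⁻¹, inv_mem hk, fun a => ?_⟩
      rw [Equiv.Perm.eq_inv_iff_eq, ← hk', perm_apply_inv]
  obtain ⟨hcy, hcard⟩ := hcycleT
  set T : Equiv.Perm X := Equiv.ofBijective _ hT with hTdef
  have hTa : ∀ x, T x = op x x := fun _ => rfl
  by_cases hsf : ∀ y, opY y y = y
  · right
    have hsub : Subsingleton Y := rump_cycle_set opY hbY hcY hsf (by
      intro a b
      obtain ⟨a, rfl⟩ := hf a
      obtain ⟨b, rfl⟩ := hf b
      obtain ⟨g, hg, rfl⟩ := hind a b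
      obtain ⟨k, hk, hk'⟩ := hlift g hg
      exact ⟨k, hk, (hk' a).symm⟩)
    obtain ⟨x, _⟩ := hcy
    have : Nonempty Y := ⟨f x⟩
    exact Nat.card_of_subsingleton (f x)
  · left
    refine ⟨?_, hf⟩
    push Not at hsf
    obtain ⟨y, hy⟩ := hsf
    let TY : Y → Y := fun y => opY y y
    have hsemi : Function.Semiconj f T TY := fun x => by rw [hTa]; exact hom x x
    have hTp : T ^ p = 1 := by rw [← hcard, ← hcy.orderOf, pow_orderOf_eq_one]
    have hmoved : ∀ x, f x = y → T x ≠ x := by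
      intro x hx h
      apply hy
      have := hsemi x
      rw [h, hx] at this
      exact this.symm
    have hfib : ∀ x₁ x₂, f x₁ = y → f x₂ = y → x₁ = x₂ := by
      intro x₁ x₂ h₁ h₂
      obtain ⟨i, hi⟩ := hcy.exists_pow_eq (hmoved x₁ h₁) (hmoved x₂ h₂)
      have key : ∀ n, f ((T ^ n) x₁) = TY^[n] y := by
        intro n
        have := hsemi.iterate_right n x₁
        rw [h₁] at this
        rw [← this, Equiv.Perm.iterate_eq_pow]
      have e1 : Function.IsPeriodicPt TY i y := by
        have := key i
        rw [hi, h₂] at this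
        exact this.symm
      have e2 : Function.IsPeriodicPt TY p y := by
        have := key p
        rw [hTp, Equiv.Perm.one_apply, h₁] at this
        exact this.symm
      have hpi : p ∣ i := by
        by_contra hpi
        have hc : Nat.gcd p i = 1 := (Nat.Prime.coprime_iff_not_dvd hp).2 hpi
        have e3 := e2.gcd e1
        rw [hc] at e3
        exact hy e3
      obtain ⟨j, rfl⟩ := hpi
      rw [pow_mul, hTp, one_pow] at hi
      exact hi
    intro a b hab
    obtain ⟨x, hx⟩ := hf y
    obtain ⟨g, hg, hga⟩ := hind a x
    obtain ⟨k, -, hk⟩ := hlift g hg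
    apply g.injective
    apply hfib
    · rw [hga, hx]
    · rw [hk, ← hab, ← hk, hga, hx]
end

section
/- Let X be a finite non-degenerate cycle set such that the squaring map T is the identity and |X| > 1. Then X is decomposable: there exist nonempty disjoint subsets Y₁, Y₂ with X = Y₁ ∪ Y₂ such that Y₁ and Y₂ are closed under the cycle set operation restricted to them (equivalently, 𝒢(X) does not act transitively on X). -/
open Polynomial in
theorem rump_roots_sum {N : ℕ} (hN : N ≠ 0) (s : Multiset ℂ) (hs : ∀ z ∈ s, z ^ N = 1)
    (hcard : s.card ≠ 0)
    (hintg : IsIntegral ℤ (s.sum / (s.card : ℂ))) : s.sum = 0 ∨ ‖s.sum‖ = s.card := by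
  by_cases h0 : s.sum = 0
  · exact Or.inl h0
  right
  have : NeZero N := ⟨hN⟩
  set ω := Complex.exp (2 * ↑Real.pi * Complex.I / N) with hω
  have hprim : IsPrimitiveRoot ω N := Complex.isPrimitiveRoot_exp N hN
  let K := IntermediateField.adjoin ℚ {ω}
  have hωint : IsIntegral ℚ ω := (hprim.isIntegral (Nat.pos_of_ne_zero hN)).tower_top
  have hfd : FiniteDimensional ℚ K := IntermediateField.adjoin.finiteDimensional hωint
  have : NumberField K := { to_charZero := inferInstance, to_finiteDimensional := hfd }
  have hωK : ω ∈ K := IntermediateField.mem_adjoin_simple_self ℚ ω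
  have hzK : ∀ z ∈ s, z ∈ K := by
    intro z hz
    obtain ⟨i, -, rfl⟩ := hprim.eq_pow_of_pow_eq_one (hs z hz)
    exact pow_mem hωK i
  obtain ⟨t, ht⟩ : ∃ t : Multiset K, t.map (algebraMap K ℂ) = s := by
    refine ⟨s.attach.map (fun z => ⟨z.1, hzK z.1 z.2⟩), ?_⟩
    rw [Multiset.map_map]
    exact Multiset.attach_map_val s
  have htc : t.card = s.card := by rw [← ht, Multiset.card_map]
  have htr : ∀ z ∈ t, z ^ N = 1 := by
    intro z hz
    have := hs (algebraMap K ℂ z) (by rw [← ht]; exact Multiset.mem_map_of_mem _ hz)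
    rw [← map_pow] at this
    exact (algebraMap K ℂ).injective (by rw [this, map_one])
  have hts : algebraMap K ℂ t.sum = s.sum := by
    rw [← ht, ← Multiset.sum_hom]
  set x : K := t.sum / (s.card : K) with hx
  have hxmap : algebraMap K ℂ x = s.sum / s.card := by
    rw [hx, map_div₀, hts, map_natCast]
  have hcC : (s.card : ℂ) ≠ 0 := by exact_mod_cast hcard
  have hx0 : x ≠ 0 := by
    intro h
    rw [h, map_zero] at hxmap
    exact div_ne_zero h0 hcC hxmap.symm
  have hxi : IsIntegral ℤ x := by
    rw [← hxmap] at hintg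
    exact (isIntegral_algebraMap_iff (algebraMap K ℂ).injective).1 hintg
  have hφ : ∀ φ : K →+* ℂ, ‖φ x‖ ≤ 1 := by
    intro φ
    rw [hx, map_div₀, map_natCast, norm_div, ← Multiset.sum_hom, Complex.norm_natCast]
    have hle : ‖(t.map φ).sum‖ ≤ s.card := by
      calc ‖(t.map φ).sum‖ ≤ ((t.map φ).map (fun z => ‖z‖)).sum := norm_multiset_sum_le _
        _ = ((t.map φ).map (fun z => (1:ℝ))).sum := by
            congr 1
            apply Multiset.map_congr rfl
            intro z hz
            obtain ⟨y, hy, rfl⟩ := Multiset.mem_map.1 hz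
            exact Complex.norm_eq_one_of_pow_eq_one (n := N) (by rw [← map_pow, htr y hy, map_one]) hN
        _ = s.card := by simp [htc]
    exact div_le_one_of_le₀ hle (Nat.cast_nonneg _)
  obtain ⟨n, hn, hxn⟩ := NumberField.Embeddings.pow_eq_one_of_norm_le_one K ℂ hx0 hxi hφ
  have h1 : ‖s.sum / (s.card : ℂ)‖ = 1 := by
    rw [← hxmap]
    exact Complex.norm_eq_one_of_pow_eq_one (n := n) (by rw [← map_pow, hxn, map_one]) hn.ne'
  rw [norm_div, Complex.norm_natCast] at h1
  have : (s.card : ℝ) ≠ 0 := by exact_mod_cast hcard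
  field_simp at h1
  exact h1

/-- unit complex numbers whose sum has maximal norm are equal -/
theorem rump_all_eq (s : Multiset ℂ) (hs : ∀ z ∈ s, ‖z‖ = 1) (h : ‖s.sum‖ = s.card) (h0 : s.card ≠ 0) :
    ∃ c, ∀ z ∈ s, z = c := by
  have hc : (s.card : ℂ) ≠ 0 := by exact_mod_cast h0
  have hsum0 : s.sum ≠ 0 := by
    intro h'
    rw [h', norm_zero] at h
    exact h0 (by exact_mod_cast h.symm)
  -- u = unit vector in the direction of sum
  set u : ℂ := s.sum / s.card with hu
  have hun : ‖u‖ = 1 := by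
    rw [hu, norm_div, h, Complex.norm_natCast]
    exact div_self (by exact_mod_cast h0)
  refine ⟨u, ?_⟩
  -- ∑ ‖z - u‖^2 = 0
  have key : (s.map (fun z => (1 - (z * (starRingEnd ℂ) u).re))).sum = 0 := by
    have e1 : (s.map (fun z => (z * (starRingEnd ℂ) u).re)).sum = (s.sum * (starRingEnd ℂ) u).re := by
      have gen : ∀ w : ℂ, ∀ t : Multiset ℂ, (t.map (fun z => (z * w).re)).sum = (t.sum * w).re := by
        intro w t
        induction t using Multiset.induction with
        | empty => simp
        | cons a t ih => simp only [Multiset.map_cons, Multiset.sum_cons, ih, add_mul, Complex.add_re]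
      exact gen _ s
    rw [Multiset.sum_map_sub, e1]
    have : s.sum = s.card * u := by rw [hu]; field_simp
    rw [this, mul_assoc, Complex.mul_conj, Complex.normSq_eq_norm_sq, hun]
    simp
  intro z hz
  have hnn : ∀ r ∈ s.map (fun z => (1 - (z * (starRingEnd ℂ) u).re)), 0 ≤ r := by
    intro r hr
    obtain ⟨y, hy, rfl⟩ := Multiset.mem_map.1 hr
    have : (y * (starRingEnd ℂ) u).re ≤ ‖y * (starRingEnd ℂ) u‖ := Complex.re_le_norm _
    rw [norm_mul, RCLike.norm_conj, hun, hs y hy] at this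
    linarith
  have hm := Multiset.mem_map_of_mem (fun z => (1 - (z * (starRingEnd ℂ) u).re)) hz
  have this := le_antisymm ((Multiset.single_le_sum hnn _ hm).trans key.le) (hnn _ hm)
  have hre : z.re * u.re + z.im * u.im = 1 := by
    simp [Complex.mul_re] at this; linarith
  have h1 := hs z hz
  have h2 : z.re^2 + z.im^2 = 1 := by
    have := Complex.sq_norm z; rw [h1, Complex.normSq_apply] at this; nlinarith
  have h3 : u.re^2 + u.im^2 = 1 := by
    have := Complex.sq_norm u; rw [hun, Complex.normSq_apply] at this; nlinarith
  have h4 : (z.re - u.re)^2 + (z.im-u.im)^2 = 0 := by nlinarith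
  apply Complex.ext
  · nlinarith [sq_nonneg (z.re - u.re), sq_nonneg (z.im-u.im)]
  · nlinarith [sq_nonneg (z.re - u.re), sq_nonneg (z.im-u.im)]

open Polynomial in
theorem rump_matrix_scalar {d N : ℕ} (hd : d ≠ 0) (hN : N ≠ 0) (M : Matrix (Fin d) (Fin d) ℂ)
    (hM : M ^ N = 1) (hintg : IsIntegral ℤ (M.trace / (d : ℂ))) :
    M.trace = 0 ∨ ∃ c : ℂ, M = Matrix.scalar (Fin d) c := by
  have hdeg : M.charpoly.roots.card = d := by
    rw [Polynomial.splits_iff_card_roots.1 (IsAlgClosed.splits M.charpoly)]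
    simp
  have hroot : ∀ z ∈ M.charpoly.roots, z ^ N = 1 := by
    intro z hz
    have hz' : M.charpoly.IsRoot z := (mem_roots'.1 hz).2
    have hsp := Matrix.mem_spectrum_iff_isRoot_charpoly.2 hz'
    have h2 := spectrum.subset_polynomial_aeval M (X ^ N - 1 : ℂ[X]) ⟨z, hsp, rfl⟩
    have : Nonempty (Fin d) := ⟨⟨0, Nat.pos_of_ne_zero hd⟩⟩
    simp only [map_sub, map_pow, aeval_X, hM, map_one, sub_self, spectrum.zero_eq] at h2
    simp at h2
    linear_combination h2
  rw [Matrix.trace_eq_sum_roots_charpoly] at hintg ⊢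
  rcases rump_roots_sum hN M.charpoly.roots hroot (by rw [hdeg]; exact hd)
    (by rw [hdeg]; exact hintg) with h | h
  · exact Or.inl h
  right
  obtain ⟨c, hc⟩ := rump_all_eq M.charpoly.roots
    (fun z hz => Complex.norm_eq_one_of_pow_eq_one (hroot z hz) hN) h (by rw [hdeg]; exact hd)
  refine ⟨c, ?_⟩
  have hrep : M.charpoly.roots = Multiset.replicate d c := by
    exact Multiset.eq_replicate.2 ⟨hdeg, hc⟩
  have hcp : M.charpoly = (X - C c) ^ d := by
    have := (IsAlgClosed.splits M.charpoly).eq_prod_roots_of_monic M.charpoly_monic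
    rw [this, hrep]; simp
  have h1 : minpoly ℂ M ∣ (X - C c) ^ d := by
    rw [← hcp]; exact minpoly.dvd _ _ (Matrix.aeval_self_charpoly M)
  have h2 : minpoly ℂ M ∣ X ^ N - 1 := by
    apply minpoly.dvd; simp [hM]
  have hsf : Squarefree (minpoly ℂ M) :=
    (Polynomial.X_pow_sub_one_separable_iff.2 (by exact_mod_cast hN)).squarefree.squarefree_of_dvd h2
  have h3 : minpoly ℂ M ∣ X - C c := (hsf.dvd_pow_iff_dvd hd).1 h1
  have h4 : aeval M (X - C c) = 0 := by
    obtain ⟨q, hq⟩ := h3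
    rw [hq, map_mul, minpoly.aeval, zero_mul]
  simp only [map_sub, aeval_X, aeval_C, sub_eq_zero] at h4
  exact h4
universe u

theorem rump_trace_integral {d N : ℕ} (hN : N ≠ 0) (hd : d ≠ 0) (M : Matrix (Fin d) (Fin d) ℂ)
    (hM : M ^ N = 1) : IsIntegral ℤ M.trace := by
  rw [Matrix.trace_eq_sum_roots_charpoly]
  apply IsIntegral.multiset_sum
  intro z hz
  have hz' : M.charpoly.IsRoot z := (Polynomial.mem_roots'.1 hz).2
  have hsp := Matrix.mem_spectrum_iff_isRoot_charpoly.2 hz'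
  have h2 := spectrum.subset_polynomial_aeval M (Polynomial.X ^ N - 1 : Polynomial ℂ) ⟨z, hsp, rfl⟩
  have : Nonempty (Fin d) := ⟨⟨0, Nat.pos_of_ne_zero hd⟩⟩
  simp only [map_sub, map_pow, Polynomial.aeval_X, hM, map_one, sub_self, spectrum.zero_eq] at h2
  simp at h2
  have h3 : z ^ N = 1 := by linear_combination h2
  refine ⟨Polynomial.X ^ N - 1, Polynomial.monic_X_pow_sub_C 1 hN, ?_⟩
  simp [h3]

theorem rump_trace_mulLeft {n : ℕ} (d : Fin n → ℕ) (x : Π i, Matrix (Fin (d i)) (Fin (d i)) ℂ) :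
    LinearMap.trace ℂ _ (LinearMap.mulLeft ℂ x) = ∑ i, (d i : ℂ) * (x i).trace := by
  classical
  rw [LinearMap.trace_eq_matrix_trace ℂ
    (Pi.basis (fun i => Matrix.stdBasis ℂ (Fin (d i)) (Fin (d i))))]
  rw [Matrix.trace, Fintype.sum_sigma]
  apply Finset.sum_congr rfl
  intro i _
  rw [Fintype.sum_prod_type]
  have key : ∀ a b : Fin (d i), (LinearMap.toMatrix
      (Pi.basis (fun i => Matrix.stdBasis ℂ (Fin (d i)) (Fin (d i))))
      (Pi.basis (fun i => Matrix.stdBasis ℂ (Fin (d i)) (Fin (d i))))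
      (LinearMap.mulLeft ℂ x)).diag ⟨i, (a, b)⟩ = x i a a := by
    intro a b
    rw [Matrix.diag_apply, LinearMap.toMatrix_apply, LinearMap.mulLeft_apply, Pi.basis_repr,
      Pi.basis_apply, Matrix.stdBasis_eq_single, Pi.mul_apply, Pi.single_eq_same]
    have : ∀ M : Matrix (Fin (d i)) (Fin (d i)) ℂ,
        (Matrix.stdBasis ℂ (Fin (d i)) (Fin (d i))).repr M (a, b) = M a b := by
      intro M
      simp [Matrix.stdBasis]
    rw [this, Matrix.mul_single_apply_same, mul_one]
  simp only [key]
  simp [Matrix.trace, Finset.mul_sum]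

theorem rump_trace_group {G : Type*} [Group G] [Finite G] (z : G) (hz : z ≠ 1) :
    LinearMap.trace ℂ _ (LinearMap.mulLeft ℂ (MonoidAlgebra.of ℂ G z)) = 0 := by
  classical
  have := Fintype.ofFinite G
  rw [LinearMap.trace_eq_matrix_trace ℂ (MonoidAlgebra.basis G ℂ)]
  rw [Matrix.trace]
  apply Finset.sum_eq_zero
  intro g _
  rw [Matrix.diag_apply, LinearMap.toMatrix_apply, LinearMap.mulLeft_apply]
  simp [MonoidAlgebra.basis, MonoidAlgebra.single_mul_single, Finsupp.single_apply, hz]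

theorem rump_central_scalar {G : Type*} [Group G] {d : ℕ}
    (f : MonoidAlgebra ℂ G →ₐ[ℂ] Matrix (Fin d) (Fin d) ℂ) (hf : Function.Surjective f)
    (a : MonoidAlgebra ℂ G) (ha : ∀ g : G, MonoidAlgebra.of ℂ G g * a = a * MonoidAlgebra.of ℂ G g) :
    ∃ c : ℂ, f a = Matrix.scalar (Fin d) c := by
  have hc : ∀ b, b * a = a * b := by
    intro b
    induction b using MonoidAlgebra.induction_on with
    | of g => exact ha g
    | add x y hx hy => rw [add_mul, mul_add, hx, hy]
    | smul r x hx => rw [smul_mul_assoc, mul_smul_comm, hx]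
  have hmem : f a ∈ Set.center (Matrix (Fin d) (Fin d) ℂ) := by
    rw [Semigroup.mem_center_iff]
    intro M
    obtain ⟨b, rfl⟩ := hf M
    rw [← map_mul, ← map_mul, hc]
  rw [Matrix.center_eq_range] at hmem
  obtain ⟨c, hc⟩ := hmem
  exact ⟨c, hc.symm⟩

theorem rump_rep_trivial {G : Type*} [Group G] {d : ℕ}
    (f : MonoidAlgebra ℂ G →ₐ[ℂ] Matrix (Fin d) (Fin d) ℂ)
    (h : ∀ g, f (MonoidAlgebra.of ℂ G g) = 1) (a : MonoidAlgebra ℂ G) :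
    f a = Matrix.scalar (Fin d) (MonoidAlgebra.lift ℂ ℂ G 1 a) := by
  induction a using MonoidAlgebra.induction_on with
  | of g => rw [h]; simp
  | add x y hx hy => rw [map_add, map_add, map_add, hx, hy]
  | smul r x hx => rw [map_smul, map_smul, hx]; ext i j; simp [Matrix.scalar_apply, Matrix.diagonal_apply]

theorem rump_dim_one {G : Type*} [Group G] {d : ℕ} (hd : d ≠ 0)
    (f : MonoidAlgebra ℂ G →ₐ[ℂ] Matrix (Fin d) (Fin d) ℂ) (hf : Function.Surjective f)
    (h : ∀ g, f (MonoidAlgebra.of ℂ G g) = 1) : d = 1 := by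
  by_contra hne
  have h2 : 1 < d := by omega
  obtain ⟨a, ha⟩ := hf (Matrix.single ⟨0, by omega⟩ ⟨1, h2⟩ 1)
  rw [rump_rep_trivial f h a] at ha
  have := congrFun (congrFun ha ⟨0, by omega⟩) ⟨1, h2⟩
  simp [Matrix.scalar_apply, Matrix.diagonal_apply] at this

open Classical in
theorem rump_rep_cases {G : Type*} [Group G] [Fintype G] [IsSimpleGroup G]
    (hna : ¬ ∀ a b : G, a * b = b * a) (z : G) (hz : z ≠ 1) (p k : ℕ) (hp : p.Prime)
    (hcl : (Finset.univ.filter (fun g => IsConj z g)).card = p ^ k)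
    {d : ℕ} (hd : d ≠ 0)
    (f : MonoidAlgebra ℂ G →ₐ[ℂ] Matrix (Fin d) (Fin d) ℂ) (hf : Function.Surjective f) :
    (∀ g, f (MonoidAlgebra.of ℂ G g) = 1) ∨
      ∃ y : ℂ, IsIntegral ℤ y ∧ (d : ℂ) * (f (MonoidAlgebra.of ℂ G z)).trace = p * y := by
  set P : G →* Matrix (Fin d) (Fin d) ℂ := (f : _ →* _).comp (MonoidAlgebra.of ℂ G) with hP
  have hPd : ∀ g, f (MonoidAlgebra.of ℂ G g) = P g := fun g => rfl
  simp only [hPd]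
  have hdC : (d : ℂ) ≠ 0 := by exact_mod_cast hd
  have hcardG : Fintype.card G ≠ 0 := Fintype.card_ne_zero
  have hfin : ∀ g, P g ^ (Fintype.card G) = 1 := by
    intro g; rw [← map_pow, pow_card_eq_one, map_one]
  have hχ : IsIntegral ℤ (P z).trace := rump_trace_integral hcardG hd _ (hfin z)
  by_cases hpd : p ∣ d
  · right
    obtain ⟨e, rfl⟩ := hpd
    refine ⟨e * (P z).trace, ?_, by push_cast; ring⟩
    exact (isIntegral_algebraMap (R := ℤ) (A := ℂ) (x := (e : ℤ))).mul hχ |> fun h => by simpa using h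
  -- class sum
  set C : MonoidAlgebra ℂ G := ∑ g ∈ Finset.univ.filter (fun g => IsConj z g), MonoidAlgebra.of ℂ G g with hC
  have hCc : ∀ g : G, MonoidAlgebra.of ℂ G g * C = C * MonoidAlgebra.of ℂ G g := by
    intro g
    rw [hC, Finset.mul_sum, Finset.sum_mul]
    refine Finset.sum_bij' (fun h _ => g * h * g⁻¹) (fun h _ => g⁻¹ * h * g) ?_ ?_ ?_ ?_ ?_
    · intro h hh
      simp only [Finset.mem_filter, Finset.mem_univ, true_and] at hh ⊢
      exact hh.trans (isConj_iff.2 ⟨g, rfl⟩)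
    · intro h hh
      simp only [Finset.mem_filter, Finset.mem_univ, true_and] at hh ⊢
      exact hh.trans (isConj_iff.2 ⟨g⁻¹, by group⟩)
    · intro h hh; group
    · intro h hh; group
    · intro h hh
      rw [← map_mul, ← map_mul]; congr 1; group
  obtain ⟨w, hw⟩ := rump_central_scalar f hf C hCc
  have hwint : IsIntegral ℤ w := by
    let C' : MonoidAlgebra ℤ G := ∑ g ∈ Finset.univ.filter (fun g => IsConj z g), MonoidAlgebra.of ℤ G g
    have h1 : IsIntegral ℤ C' := by
      have : Module.Finite ℤ (MonoidAlgebra ℤ G) := Module.Finite.of_basis (MonoidAlgebra.basis G ℤ)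
      exact IsIntegral.of_finite ℤ C'
    let F : MonoidAlgebra ℤ G →ₐ[ℤ] Matrix (Fin d) (Fin d) ℂ := MonoidAlgebra.lift ℤ _ G P
    have h2 : F C' = Matrix.scalar (Fin d) w := by
      rw [← hw, hC]
      simp only [C', map_sum, hPd]
      apply Finset.sum_congr rfl
      intro g _
      simp [F]
    have h3 : IsIntegral ℤ (Matrix.scalar (Fin d) w) := h2 ▸ h1.map F
    have : Nonempty (Fin d) := ⟨⟨0, Nat.pos_of_ne_zero hd⟩⟩
    have hinj : Function.Injective (algebraMap ℂ (Matrix (Fin d) (Fin d) ℂ)) :=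
      (algebraMap ℂ (Matrix (Fin d) (Fin d) ℂ)).injective
    exact (isIntegral_algebraMap_iff hinj).1 h3
  have htr : (d : ℂ) * w = (p : ℂ) ^ k * (P z).trace := by
    have h1 : (f C).trace = d * w := by
      rw [hw]; simp [Matrix.trace, Matrix.scalar_apply]
    rw [← h1, hC, map_sum, Matrix.trace_sum]
    have : ∀ g ∈ Finset.univ.filter (fun g => IsConj z g),
        (f (MonoidAlgebra.of ℂ G g)).trace = (P z).trace := by
      intro g hg
      obtain ⟨c, rfl⟩ := isConj_iff.1 (Finset.mem_filter.1 hg).2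
      rw [hPd, map_mul, Matrix.trace_mul_comm, ← map_mul]
      congr 2; group
    rw [Finset.sum_congr rfl this, Finset.sum_const, hcl]
    simp
  have hco : IsCoprime (d : ℤ) ((p : ℤ) ^ k) := by
    apply IsCoprime.pow_right
    rw [Nat.isCoprime_iff_coprime]
    exact ((Nat.Prime.coprime_iff_not_dvd hp).2 hpd).symm
  have hquot : IsIntegral ℤ ((P z).trace / (d : ℂ)) := by
    obtain ⟨u, v, huv⟩ := hco
    have huv' : (u : ℂ) * d + v * (p : ℂ) ^ k = 1 := by exact_mod_cast huv
    have : (P z).trace / (d : ℂ) = (u : ℂ) * (P z).trace + (v : ℂ) * w := by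
      field_simp
      linear_combination (-(P z).trace) * huv' - (v : ℂ) * htr
    rw [this]
    have hu : ∀ u : ℤ, IsIntegral ℤ (u : ℂ) := fun u => isIntegral_algebraMap (R := ℤ) (A := ℂ) (x := u)
    exact ((hu u).mul hχ).add ((hu v).mul hwint)
  rcases rump_matrix_scalar hd hcardG (P z) (hfin z) hquot with h0 | ⟨c, hc⟩
  · right
    exact ⟨0, isIntegral_zero, by rw [h0]; simp⟩
  left
  -- scalar kernel
  have hcomm_sc : ∀ (c : ℂ) (M : Matrix (Fin d) (Fin d) ℂ),
      Matrix.scalar (Fin d) c * M = M * Matrix.scalar (Fin d) c := fun c M =>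
    (Matrix.scalar_commute c (fun r => mul_comm _ _) M)
  let Nn : Subgroup G :=
    { carrier := {g | ∀ h, P g * P h = P h * P g}
      one_mem' := by intro h; simp
      mul_mem' := by
        intro a b ha hb h
        simp only [Set.mem_ofPred_eq] at ha hb
        rw [map_mul, mul_assoc, hb, ← mul_assoc, ha, mul_assoc]
      inv_mem' := by
        intro a ha h
        have h1 : P a⁻¹ * P a = 1 := by rw [← map_mul]; simp
        have h2 : P a * P a⁻¹ = 1 := by rw [← map_mul]; simp
        calc P a⁻¹ * P h = P a⁻¹ * (P h * P a) * P a⁻¹ := by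
              rw [mul_assoc, mul_assoc, h2, mul_one]
          _ = P h * P a⁻¹ := by rw [← ha h, ← mul_assoc, h1, one_mul] }
  have hNn : Nn.Normal := by
    constructor
    intro a ha g h
    have h3 : P g * P g⁻¹ = 1 := by rw [← map_mul]; simp
    have h1 : P (g * a * g⁻¹) = P a := by
      rw [map_mul, map_mul, ← ha g, mul_assoc, h3, mul_one]
    rw [h1]; exact ha h
  have hzN : z ∈ Nn := by
    intro h
    rw [hc]; exact hcomm_sc c _
  have hNtop : Nn = ⊤ := by
    rcases hNn.eq_bot_or_eq_top with h | h
    · rw [h] at hzN; exact absurd (Subgroup.mem_bot.1 hzN) hz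
    · exact h
  have hcomm : ∀ a b, P a * P b = P b * P a := by
    intro a; have : a ∈ Nn := by rw [hNtop]; trivial
    exact this
  rcases (inferInstance : P.ker.Normal).eq_bot_or_eq_top with h | h
  · exfalso
    apply hna
    have hinj := (MonoidHom.ker_eq_bot_iff P).1 h
    intro a b
    apply hinj
    rw [map_mul, map_mul, hcomm]
  · intro g
    have : g ∈ P.ker := by rw [h]; trivial
    exact this

open Classical in
theorem rump_burnside {G : Type*} [Group G] [Fintype G] [IsSimpleGroup G]
    (hna : ¬ ∀ a b : G, a * b = b * a) (z : G) (hz : z ≠ 1) (p k : ℕ) (hp : p.Prime)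
    (hcl : (Finset.univ.filter (fun g => IsConj z g)).card = p ^ k) : False := by
  have : FiniteDimensional ℂ (MonoidAlgebra ℂ G) := Module.Finite.of_basis (MonoidAlgebra.basis G ℂ)
  obtain ⟨n, d, hd, ⟨φ⟩⟩ :=
    IsSemisimpleRing.exists_algEquiv_pi_matrix_of_isAlgClosed ℂ (MonoidAlgebra ℂ G)
  let f : ∀ i, MonoidAlgebra ℂ G →ₐ[ℂ] Matrix (Fin (d i)) (Fin (d i)) ℂ := fun i =>
    (Pi.evalAlgHom ℂ (fun i => Matrix (Fin (d i)) (Fin (d i)) ℂ) i).comp φ.toAlgHom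
  have hfφ : ∀ i a, f i a = φ a i := fun i a => rfl
  have hf : ∀ i, Function.Surjective (f i) := by
    intro i M
    refine ⟨φ.symm (Pi.single i M), ?_⟩
    rw [hfφ, AlgEquiv.apply_symm_apply, Pi.single_eq_same]
  have htrace : ∑ i, (d i : ℂ) * (f i (MonoidAlgebra.of ℂ G z)).trace = 0 := by
    have h1 := rump_trace_mulLeft d (φ (MonoidAlgebra.of ℂ G z))
    have h2 := LinearMap.trace_conj' (LinearMap.mulLeft ℂ (MonoidAlgebra.of ℂ G z)) φ.toLinearEquiv
    have h3 : φ.toLinearEquiv.conj (LinearMap.mulLeft ℂ (MonoidAlgebra.of ℂ G z))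
        = LinearMap.mulLeft ℂ (φ (MonoidAlgebra.of ℂ G z)) := by
      apply LinearMap.ext
      intro x
      simp [LinearEquiv.conj_apply]
    rw [h3, h1, rump_trace_group z hz] at h2
    exact h2
  have hcases := fun i => rump_rep_cases hna z hz p k hp hcl (hd i).ne (f i) (hf i)
  -- existence of the trivial index
  obtain ⟨i₀, hi₀⟩ : ∃ i, ∀ g, f i (MonoidAlgebra.of ℂ G g) = 1 := by
    set s : MonoidAlgebra ℂ G := ∑ g : G, MonoidAlgebra.of ℂ G g with hs
    have hgs : ∀ g, MonoidAlgebra.of ℂ G g * s = s := by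
      intro g
      rw [hs, Finset.mul_sum]
      simp only [← map_mul]
      exact Fintype.sum_equiv (Equiv.mulLeft g) _ _ (fun x => rfl)
    have hsg : ∀ g, s * MonoidAlgebra.of ℂ G g = s := by
      intro g
      rw [hs, Finset.sum_mul]
      simp only [← map_mul]
      exact Fintype.sum_equiv (Equiv.mulRight g) _ _ (fun x => rfl)
    have hs0 : s ≠ 0 := by
      intro h
      have h1 := congrArg (MonoidAlgebra.lift ℂ ℂ G 1) h
      rw [hs, map_sum] at h1
      simp at h1
    have hφs : φ s ≠ 0 := by simpa using hs0
    obtain ⟨i, hi⟩ := Function.ne_iff.1 hφs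
    refine ⟨i, fun g => ?_⟩
    obtain ⟨c, hc⟩ := rump_central_scalar (f i) (hf i) s (fun g => by rw [hgs, hsg])
    have hc0 : c ≠ 0 := by
      rintro rfl
      apply hi
      rw [← hfφ, hc]; simp
    have h1 := congrArg (f i) (hgs g)
    rw [map_mul, hc] at h1
    have h2 : Matrix.scalar (Fin (d i)) c * Matrix.scalar (Fin (d i)) c⁻¹ = 1 := by
      rw [← map_mul, mul_inv_cancel₀ hc0, map_one]
    calc f i (MonoidAlgebra.of ℂ G g)
        = f i (MonoidAlgebra.of ℂ G g) * (Matrix.scalar (Fin (d i)) c * Matrix.scalar (Fin (d i)) c⁻¹) := by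
          rw [h2, mul_one]
      _ = 1 := by rw [← mul_assoc, h1, h2]
  have huniq : ∀ j, j ≠ i₀ → ¬ ∀ g, f j (MonoidAlgebra.of ℂ G g) = 1 := by
    intro j hj hall
    have e1 := rump_rep_trivial (f i₀) hi₀ (φ.symm (Pi.single i₀ 1))
    have e2 := rump_rep_trivial (f j) hall (φ.symm (Pi.single i₀ 1))
    rw [hfφ, AlgEquiv.apply_symm_apply] at e1 e2
    rw [Pi.single_eq_same] at e1
    rw [Pi.single_eq_of_ne hj] at e2
    have hx : ∀ i, Nonempty (Fin (d i)) := fun i => ⟨⟨0, Nat.pos_of_ne_zero (hd i).ne⟩⟩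
    have := hx i₀
    have := hx j
    have e2' := Matrix.scalar_inj.1 ((map_zero (Matrix.scalar (Fin (d j)))).trans e2)
    rw [← e2', map_zero] at e1
    exact one_ne_zero e1
  have hd1 : d i₀ = 1 := rump_dim_one (hd i₀).ne (f i₀) (hf i₀) hi₀
  have hrest : ∃ y : ℂ, IsIntegral ℤ y ∧
      ∑ i ∈ Finset.univ.erase i₀, (d i : ℂ) * (f i (MonoidAlgebra.of ℂ G z)).trace = p * y := by
    have : ∀ i ∈ Finset.univ.erase i₀, ∃ y : ℂ, IsIntegral ℤ y ∧
        (d i : ℂ) * (f i (MonoidAlgebra.of ℂ G z)).trace = p * y := fun i hi =>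
      (hcases i).resolve_left (huniq i (Finset.ne_of_mem_erase hi))
    choose! y hy1 hy2 using this
    refine ⟨∑ i ∈ Finset.univ.erase i₀, y i, IsIntegral.sum _ hy1, ?_⟩
    rw [Finset.mul_sum]
    exact Finset.sum_congr rfl hy2
  obtain ⟨y, hy, hsum⟩ := hrest
  rw [← Finset.add_sum_erase _ _ (Finset.mem_univ i₀), hsum, hi₀ z, Matrix.trace_one, Fintype.card_fin,
    hd1] at htrace
  simp only [Nat.cast_one, mul_one] at htrace
  -- y = -1/p
  have hpC : (p : ℂ) ≠ 0 := by exact_mod_cast hp.ne_zero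
  have hyq : y = algebraMap ℚ ℂ (-1 / p) := by
    simp
    field_simp
    linear_combination htrace
  rw [hyq] at hy
  have hq : IsIntegral ℤ (-1 / p : ℚ) := (isIntegral_algebraMap_iff (algebraMap ℚ ℂ).injective).1 hy
  obtain ⟨m, hm⟩ := IsIntegrallyClosed.isIntegral_iff.1 hq
  have hpQ : (p : ℚ) ≠ 0 := by exact_mod_cast hp.ne_zero
  have hm' : (m : ℚ) * p = -1 := by
    have : (m : ℚ) = -1 / p := hm
    rw [this]; field_simp
  have hm2 : m * (p : ℤ) = -1 := by exact_mod_cast hm'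
  have : (p : ℤ) ∣ 1 := ⟨-m, by linarith⟩
  have := Int.natCast_dvd_natCast.1 (this : ((p : ℕ) : ℤ) ∣ ((1 : ℕ) : ℤ))
  exact hp.one_lt.ne' (Nat.dvd_one.1 this)

/-- `G` has a `p`-complement for every prime `p`. -/
def RumpHall (G : Type*) [Group G] : Prop :=
  ∀ p : ℕ, p.Prime → ∃ H : Subgroup G, (∀ q : ℕ, q.Prime → q ∣ H.index → q = p) ∧ ¬ p ∣ Nat.card H

theorem rump_relIndex_sup {G : Type*} [Group G] [Finite G] (H N : Subgroup G) [N.Normal] :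
    H.relIndex N = H.relIndex (H ⊔ N) := by
  have h1 := Subgroup.relIndex_mul_relIndex (H ⊓ N) N (H ⊔ N) inf_le_right le_sup_right
  have h2 := Subgroup.relIndex_mul_relIndex (H ⊓ N) H (H ⊔ N) inf_le_left le_sup_left
  rw [Subgroup.inf_relIndex_right, Subgroup.relIndex_sup_right] at h1
  rw [Subgroup.inf_relIndex_left] at h2
  have h3 : N.relIndex H ≠ 0 := Subgroup.index_ne_zero_of_finite
  have : N.relIndex H * H.relIndex N = N.relIndex H * H.relIndex (H ⊔ N) := by
    rw [h2, ← h1, mul_comm]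
  exact Nat.eq_of_mul_eq_mul_left (Nat.pos_of_ne_zero h3) this

theorem RumpHall.normal {G : Type*} [Group G] [Finite G] (h : RumpHall G) (N : Subgroup G) [N.Normal] :
    RumpHall N := by
  intro p hp
  obtain ⟨H, h1, h2⟩ := h p hp
  refine ⟨H.subgroupOf N, ?_, ?_⟩
  · intro q hq hqd
    apply h1 q hq
    have h3 : (H.subgroupOf N).index = H.relIndex N := rfl
    rw [h3, rump_relIndex_sup] at hqd
    exact hqd.trans (Subgroup.relIndex_dvd_index_of_le le_sup_left)
  · intro hd
    exact h2 (hd.trans (Subgroup.card_comap_dvd_of_injective H N.subtype N.subtype_injective))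

theorem RumpHall.quotient {G : Type*} [Group G] [Finite G] (h : RumpHall G) (N : Subgroup G) [N.Normal] :
    RumpHall (G ⧸ N) := by
  intro p hp
  obtain ⟨H, h1, h2⟩ := h p hp
  refine ⟨H.map (QuotientGroup.mk' N), ?_, ?_⟩
  · intro q hq hqd
    exact h1 q hq (hqd.trans (H.index_map_dvd (QuotientGroup.mk'_surjective N)))
  · intro hd
    exact h2 (hd.trans (Subgroup.card_map_dvd _ _))

theorem rump_exists_mul {G : Type*} [Group G] [Finite G] (H L : Subgroup G)
    (hco : Nat.Coprime H.index L.index) : L.relIndex H = L.index ∧ ∀ x : G, ∃ l ∈ L, ∃ a ∈ H, x = l * a := by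
  have h1 := Subgroup.relIndex_mul_index (inf_le_left : H ⊓ L ≤ H)
  have h2 := Subgroup.relIndex_mul_index (inf_le_right : H ⊓ L ≤ L)
  rw [Subgroup.inf_relIndex_left] at h1
  have h3 : L.index ∣ L.relIndex H := by
    apply hco.symm.dvd_of_dvd_mul_right
    rw [h1, ← h2]
    exact Dvd.intro_left _ rfl
  have hst : MulAction.stabilizer H ((1 : G) : G ⧸ L) = L.subgroupOf H := by
    ext ⟨y, hy⟩
    rw [MulAction.mem_stabilizer_iff, Subgroup.mem_subgroupOf]
    change ((y * 1 : G) : G ⧸ L) = ((1 : G) : G ⧸ L) ↔ y ∈ L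
    rw [QuotientGroup.eq]
    simp
  have h4 := MulAction.index_stabilizer H ((1 : G) : G ⧸ L)
  rw [hst] at h4
  change L.relIndex H = _ at h4
  have h0 : L.relIndex H ≠ 0 := Subgroup.index_ne_zero_of_finite
  have h5 : (MulAction.orbit H ((1 : G) : G ⧸ L)).ncard ≤ Nat.card (G ⧸ L) := by
    rw [← Set.ncard_univ]
    exact Set.ncard_le_ncard (Set.subset_univ _)
  have h6 : L.index ≤ L.relIndex H := Nat.le_of_dvd (Nat.pos_of_ne_zero h0) h3
  have h7 : L.relIndex H = L.index := le_antisymm (by rw [h4]; exact h5) h6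
  refine ⟨h7, fun x => ?_⟩
  have huniv : MulAction.orbit H ((1 : G) : G ⧸ L) = Set.univ := by
    apply Set.eq_of_subset_of_ncard_le (Set.subset_univ _)
    rw [Set.ncard_univ, ← h4, h7]; rfl
  have hx : ((x⁻¹ : G) : G ⧸ L) ∈ MulAction.orbit H ((1 : G) : G ⧸ L) := by rw [huniv]; trivial
  obtain ⟨⟨a, ha⟩, hax⟩ := hx
  have hax' : ((a * 1 : G) : G ⧸ L) = ((x⁻¹ : G) : G ⧸ L) := hax
  rw [QuotientGroup.eq] at hax'
  refine ⟨(a⁻¹ * x⁻¹)⁻¹, L.inv_mem (by simpa using hax'), a⁻¹, H.inv_mem ha, by group⟩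

theorem rump_coprime_of {m n p q : ℕ} (hpq : p ≠ q) (hm : ∀ r : ℕ, r.Prime → r ∣ m → r = p)
    (hn : ∀ r : ℕ, r.Prime → r ∣ n → r = q) : Nat.Coprime m n := by
  apply Nat.Coprime.symm
  by_contra h
  obtain ⟨r, hr, h1, h2⟩ := Nat.Prime.not_coprime_iff_dvd.1 h
  exact hpq ((hm r hr h2).symm.trans (hn r hr h1))

theorem RumpHall.complement {G : Type*} [Group G] [Finite G] (h : RumpHall G) (H : Subgroup G) (p : ℕ)
    (h1 : ∀ q : ℕ, q.Prime → q ∣ H.index → q = p) (h2 : ¬ p ∣ Nat.card H) : RumpHall H := by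
  intro q hq
  by_cases hqp : q = p
  · subst hqp
    refine ⟨⊤, ?_, ?_⟩
    · intro r hr hd
      rw [Subgroup.index_top] at hd
      exact absurd (Nat.dvd_one.1 hd) hr.ne_one
    · rwa [Subgroup.card_top]
  · obtain ⟨L, hL1, hL2⟩ := h q hq
    have hrel := (rump_exists_mul H L (rump_coprime_of (Ne.symm hqp) h1 hL1)).1
    refine ⟨L.subgroupOf H, ?_, ?_⟩
    · intro r hr hd
      have h3 : (L.subgroupOf H).index = L.relIndex H := rfl
      rw [h3, hrel] at hd
      exact hL1 r hr hd
    · intro hd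
      exact hL2 (hd.trans (Subgroup.card_comap_dvd_of_injective L H.subtype H.subtype_injective))

theorem rump_core {G : Type*} [Group G] [Finite G] (N : Subgroup G) [N.Normal] (r : ℕ) (hr : r.Prime)
    (M : Subgroup N) (hM : M.Normal) (hMb : M ≠ ⊥) (hMr : IsPGroup r M) :
    ∃ D : Subgroup G, D.Normal ∧ D ≠ ⊥ ∧ IsPGroup r D := by
  have : Fact r.Prime := ⟨hr⟩
  let D : Subgroup N := ⨅ P : Sylow r N, (P : Subgroup N)
  have hD : D.Characteristic := by
    rw [Subgroup.characteristic_iff_le_comap]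
    intro φ x hx
    rw [Subgroup.mem_comap, Subgroup.mem_iInf]
    intro P
    have h1 := (Subgroup.mem_iInf.1 hx) (P.mapSurjective (f := φ.symm.toMonoidHom) φ.symm.surjective)
    change x ∈ (P : Subgroup N).map φ.symm.toMonoidHom at h1
    obtain ⟨y, hy, hyx⟩ := Subgroup.mem_map.1 h1
    have : φ.toMonoidHom x = y := by
      rw [← hyx]; simp
    rw [this]; exact hy
  have hMD : M ≤ D := by
    refine le_iInf fun P => ?_
    have h1 : IsPGroup r (M ⊔ (P : Subgroup N) : Subgroup N) := hMr.to_sup_of_normal_left P.isPGroup'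
    have h2 := P.is_maximal' h1 le_sup_right
    rw [← h2]; exact le_sup_left
  refine ⟨D.map N.subtype, inferInstance, ?_, ?_⟩
  · intro hb
    rw [Subgroup.map_eq_bot_iff_of_injective _ N.subtype_injective] at hb
    exact hMb (le_bot_iff.1 (hb ▸ hMD))
  · have P : Sylow r N := default
    have h1 : IsPGroup r D := P.isPGroup'.to_le (iInf_le _ P)
    exact h1.map N.subtype

open Classical in
theorem rump_burnside_sylow {G : Type*} [Group G] [Finite G] [IsSimpleGroup G]
    (hna : ¬ ∀ a b : G, a * b = b * a) (p r : ℕ) (hp : p.Prime) (hr : r.Prime)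
    (hrG : r ∣ Nat.card G)
    (hG : ∀ q : ℕ, q.Prime → q ∣ Nat.card G → q = p ∨ q = r) : False := by
  have := Fintype.ofFinite G
  have : Fact r.Prime := ⟨hr⟩
  let R : Sylow r G := default
  have hRnt : Nontrivial R := by
    rw [← Finite.one_lt_card_iff_nontrivial]
    have : r ∣ Nat.card R := R.dvd_card_of_dvd_card hrG
    exact lt_of_lt_of_le hr.one_lt (Nat.le_of_dvd Nat.card_pos this)
  have hcnt : Nontrivial (Subgroup.center R) := R.isPGroup'.center_nontrivial
  obtain ⟨⟨z, hz⟩, hz1⟩ := exists_ne (1 : Subgroup.center R)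
  have hzne : (z : G) ≠ 1 := by
    intro h
    apply hz1
    apply Subtype.ext
    apply Subtype.ext
    exact h
  have hcen : ∀ a ∈ R, a * (z : G) = z * a := by
    intro a ha
    have := Subgroup.mem_center_iff.1 hz ⟨a, ha⟩
    exact congrArg Subtype.val this
  let S : Subgroup G := (MulAction.stabilizer (ConjAct G) (z : G)).comap ConjAct.toConjAct.toMonoidHom
  have hRS : (R : Subgroup G) ≤ S := by
    intro a ha
    rw [Subgroup.mem_comap, MulAction.mem_stabilizer_iff]
    change ConjAct.toConjAct a • (z : G) = z
    rw [ConjAct.toConjAct_smul, hcen a ha]; group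
  have hSi : S.index = (MulAction.stabilizer (ConjAct G) (z : G)).index :=
    Subgroup.index_comap_of_surjective _ ConjAct.toConjAct.surjective
  have hcard : (Finset.univ.filter (fun g => IsConj (z : G) g)).card = S.index := by
    rw [hSi, MulAction.index_stabilizer, ConjAct.orbit_eq_carrier_conjClasses, ← Set.ncard_coe_finset]
    congr 1
    ext g
    rw [ConjClasses.mem_carrier_iff_mk_eq, ConjClasses.mk_eq_mk_iff_isConj]
    rw [Finset.mem_coe, Finset.mem_filter]
    exact ⟨fun h => h.2.symm, fun h => ⟨Finset.mem_univ _, h.symm⟩⟩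
  have hSd : S.index ∣ (R : Subgroup G).index := Subgroup.index_dvd_of_le hRS
  have hpow := Nat.eq_prime_pow_of_unique_prime_dvd (n := S.index) (p := p)
    Subgroup.index_ne_zero_of_finite (by
      intro d hd hdS
      rcases hG d hd (hdS.trans (Subgroup.index_dvd_card S)) with h | h
      · exact h
      · subst h
        exact absurd (hdS.trans hSd) R.not_dvd_index)
  exact rump_burnside hna z hzne p _ hp (hcard.trans hpow)

theorem rump_hall_normal (n : ℕ) : ∀ (G : Type u) [Group G] [Finite G] [Nontrivial G], Nat.card G = n →
    RumpHall G → ∃ r : ℕ, r.Prime ∧ ∃ N : Subgroup G, N.Normal ∧ N ≠ ⊥ ∧ IsPGroup r N := by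
  induction n using Nat.strong_induction_on with
  | _ n ih =>
  intro G _ _ _ hn hG
  subst hn
  have hlt : ∀ H : Subgroup G, H ≠ ⊤ → Nat.card H < Nat.card G := by
    intro H hH
    refine lt_of_le_of_ne (Nat.le_of_dvd Nat.card_pos H.card_subgroup_dvd_card) ?_
    intro h; exact hH (Subgroup.eq_top_of_card_eq H h)
  by_cases hsimp : ∀ N : Subgroup G, N.Normal → N = ⊥ ∨ N = ⊤
  swap
  · push Not at hsimp
    obtain ⟨N, hN, hNb, hNt⟩ := hsimp
    have : Nontrivial N := (Subgroup.nontrivial_iff_ne_bot N).2 hNb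
    obtain ⟨r, hr, M, hM1, hM2, hM3⟩ := ih _ (hlt N hNt) N rfl (hG.normal N)
    exact ⟨r, hr, rump_core N r hr M hM1 hM2 hM3⟩
  have hS : IsSimpleGroup G := ⟨hsimp⟩
  have hcard1 : Nat.card G ≠ 1 := (Finite.one_lt_card).ne'
  obtain ⟨p, hp, hpG⟩ := Nat.exists_prime_and_dvd hcard1
  have : Fact p.Prime := ⟨hp⟩
  by_cases hna : ∀ a b : G, a * b = b * a
  · let P : Sylow p G := default
    refine ⟨p, hp, P, ⟨?_⟩, ?_, P.isPGroup'⟩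
    · intro a ha g
      rw [hna g a, mul_assoc, mul_inv_cancel, mul_one]; exact ha
    · intro hb
      have h1 := P.dvd_card_of_dvd_card hpG
      rw [hb, Subgroup.card_bot] at h1
      exact hp.ne_one (Nat.dvd_one.1 h1)
  obtain ⟨H, hH1, hH2⟩ := hG p hp
  have hHt : H ≠ ⊤ := by
    rintro rfl
    rw [Subgroup.card_top] at hH2; exact hH2 hpG
  by_cases hHb : H = ⊥
  · subst hHb
    rw [Subgroup.index_bot] at hH1
    refine ⟨p, hp, ⊤, inferInstance, top_ne_bot, ?_⟩
    apply IsPGroup.of_card (n := (Nat.card G).primeFactorsList.length)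
    rw [Subgroup.card_top]
    exact Nat.eq_prime_pow_of_unique_prime_dvd Nat.card_pos.ne' (fun {d} hd hdd => hH1 d hd hdd)
  have : Nontrivial H := (Subgroup.nontrivial_iff_ne_bot H).2 hHb
  obtain ⟨r, hr, M, hM1, hM2, hM3⟩ := ih _ (hlt H hHt) H rfl (hG.complement H p hH1 hH2)
  exfalso
  have : Fact r.Prime := ⟨hr⟩
  have hrH : r ∣ Nat.card H := by
    have : Nontrivial M := (Subgroup.nontrivial_iff_ne_bot M).2 hM2
    obtain ⟨k, hk, hk2⟩ := hM3.nontrivial_iff_card.1 this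
    refine dvd_trans ?_ M.card_subgroup_dvd_card
    rw [hk2]; exact dvd_pow_self r hk.ne'
  by_cases hs : ∃ s : ℕ, s.Prime ∧ s ∣ Nat.card G ∧ s ≠ p ∧ s ≠ r
  swap
  · push Not at hs
    refine rump_burnside_sylow hna p r hp hr (hrH.trans H.card_subgroup_dvd_card) ?_
    intro q hq hqG
    by_contra hcon
    push Not at hcon
    exact hcon.2 (hs q hq hqG hcon.1)
  obtain ⟨s, hs, hsG, hsp, hsr⟩ := hs
  obtain ⟨K, hK1, hK2⟩ := hG s hs
  let M' : Subgroup G := M.map H.subtype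
  have hM'r : IsPGroup r M' := hM3.map _
  obtain ⟨y, hy⟩ := hM'r.nonempty_fixed_point_of_prime_not_dvd_card (G ⧸ K)
    (fun hd => hsr (hK1 r hr hd).symm)
  let L := MulAction.stabilizer G y
  have hLi : L.index = K.index := MulAction.index_stabilizer_of_transitive G y
  have hLt : L ≠ ⊤ := by
    intro h
    rw [h, Subgroup.index_top] at hLi
    have : K = ⊤ := Subgroup.index_eq_one.1 hLi.symm
    rw [this, Subgroup.card_top] at hK2; exact hK2 hsG
  have hM'L : M' ≤ L := by
    intro a ha
    exact hy ⟨a, ha⟩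
  have hfac := (rump_exists_mul H L (rump_coprime_of (Ne.symm hsp) hH1 (by rw [hLi]; exact hK1))).2
  have hcl : Subgroup.normalClosure (M' : Set G) ≤ L := by
    rw [Subgroup.normalClosure, Subgroup.closure_le]
    intro x hx
    obtain ⟨a, ha, hax⟩ := Group.mem_conjugatesOfSet_iff.1 hx
    obtain ⟨c, rfl⟩ := isConj_iff.1 hax
    obtain ⟨l, hl, b, hb, rfl⟩ := hfac c
    obtain ⟨m, hm, rfl⟩ := Subgroup.mem_map.1 ha
    have h1 : b * (m : G) * b⁻¹ ∈ M' :=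
      Subgroup.mem_map.2 ⟨⟨b, hb⟩ * m * ⟨b, hb⟩⁻¹, hM1.conj_mem m hm _, rfl⟩
    have h2 : l * b * (m : G) * (l * b)⁻¹ = l * (b * (m : G) * b⁻¹) * l⁻¹ := by group
    change l * b * (m : G) * (l * b)⁻¹ ∈ L
    rw [h2]
    exact L.mul_mem (L.mul_mem hl (hM'L h1)) (L.inv_mem hl)
  rcases hsimp _ (Subgroup.normalClosure_normal (s := (M' : Set G))) with h | h
  · have h1 : M' ≤ ⊥ := h ▸ Subgroup.le_normalClosure
    have h2 : M' = ⊥ := le_bot_iff.1 h1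
    rw [Subgroup.map_eq_bot_iff_of_injective _ H.subtype_injective] at h2
    exact hM2 h2
  · exact hLt (top_le_iff.1 (h ▸ hcl))

theorem rump_prime_power_index (n : ℕ) : ∀ (G : Type u) [Group G] [Finite G], Nat.card G = n →
    RumpHall G → ∀ K : Subgroup G, K ≠ ⊤ → ∃ L : Subgroup G, K ≤ L ∧ L ≠ ⊤ ∧
      ∃ r : ℕ, r.Prime ∧ ∀ q : ℕ, q.Prime → q ∣ L.index → q = r := by
  induction n using Nat.strong_induction_on with
  | _ n ih =>
  intro G _ _ hn hG K hK
  subst hn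
  have : Nontrivial G := by
    by_contra h
    rw [not_nontrivial_iff_subsingleton] at h
    exact hK (Subsingleton.elim _ _)
  obtain ⟨r, hr, N, hN, hNb, hNr⟩ := rump_hall_normal _ G rfl hG
  by_cases hKN : K ⊔ N = ⊤
  · refine ⟨K, le_rfl, hK, r, hr, ?_⟩
    intro q hq hqd
    have h1 := rump_relIndex_sup K N
    rw [hKN, Subgroup.relIndex_top_right] at h1
    rw [← h1] at hqd
    have h2 : q ∣ Nat.card N := hqd.trans (Subgroup.index_dvd_card (K.subgroupOf N))
    have : Fact r.Prime := ⟨hr⟩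
    obtain ⟨k, hk⟩ := IsPGroup.iff_card.1 hNr
    rw [hk] at h2
    exact (Nat.prime_dvd_prime_iff_eq hq hr).1 (hq.dvd_of_dvd_pow h2)
  · have hlt : Nat.card (G ⧸ N) < Nat.card G := by
      have h1 : Nat.card N * N.index = Nat.card G := N.card_mul_index
      have h2 : 1 < Nat.card N := by
        rw [Finite.one_lt_card_iff_nontrivial]; exact (Subgroup.nontrivial_iff_ne_bot N).2 hNb
      have h3 : 0 < N.index := Nat.pos_of_ne_zero Subgroup.index_ne_zero_of_finite
      change N.index < _
      nlinarith
    have hK' : K.map (QuotientGroup.mk' N) ≠ ⊤ := by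
      intro h
      apply hKN
      have := congrArg (Subgroup.comap (QuotientGroup.mk' N)) h
      rwa [Subgroup.comap_map_eq, QuotientGroup.ker_mk', Subgroup.comap_top] at this
    obtain ⟨L, h1, h2, s, hs, h3⟩ := ih _ hlt (G ⧸ N) rfl (hG.quotient N) _ hK'
    refine ⟨L.comap (QuotientGroup.mk' N), Subgroup.map_le_iff_le_comap.1 h1, ?_, s, hs, ?_⟩
    · intro h
      apply h2
      rw [← Subgroup.map_comap_eq_self_of_surjective (QuotientGroup.mk'_surjective N) L, h,
        Subgroup.map_top_of_surjective _ (QuotientGroup.mk'_surjective N)]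
    · rw [Subgroup.index_comap_of_surjective _ (QuotientGroup.mk'_surjective N)]
      exact h3

theorem rump_ker {G A : Type*} [Group G] [Finite G] [AddCommGroup A] (e : G ≃ A) (lam : G → A ≃+ A)
    (hmul : ∀ g h, e (g * h) = e g + lam g (e h)) (m n : ℕ) (hmn : ∀ v : A, (m * n) • v = 0) :
    ∃ H : Subgroup G, (∀ g, g ∈ H ↔ m • e g = 0) ∧ (∀ q : ℕ, q.Prime → q ∣ Nat.card H → q ∣ m) ∧
      (∀ q : ℕ, q.Prime → q ∣ H.index → q ∣ n) := by
  have hA : Finite A := Finite.of_equiv G e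
  have h1 : e 1 = 0 := by
    have := hmul 1 1
    rw [mul_one] at this
    have h2 : lam 1 (e 1) = 0 := by
      have h3 : e 1 + 0 = e 1 + lam 1 (e 1) := by rw [add_zero]; exact this
      exact (add_left_cancel h3).symm
    exact (AddEquiv.map_eq_zero_iff (lam 1)).1 h2
  let H : Subgroup G :=
    { carrier := {g | m • e g = 0}
      one_mem' := by
        change m • e 1 = 0
        rw [h1, smul_zero]
      mul_mem' := by
        intro a b ha hb
        change m • e a = 0 at ha
        change m • e b = 0 at hb
        change m • e (a * b) = 0
        rw [hmul, smul_add, ha, ← map_nsmul, hb, map_zero, add_zero]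
      inv_mem' := by
        intro a ha
        change m • e a = 0 at ha
        change m • e a⁻¹ = 0
        have h2 := hmul a a⁻¹
        rw [mul_inv_cancel, h1] at h2
        have h3 : m • (e a + lam a (e a⁻¹)) = 0 := by rw [← h2, smul_zero]
        rw [smul_add, ha, zero_add, ← map_nsmul] at h3
        exact (AddEquiv.map_eq_zero_iff (lam a)).1 h3 }
  have hH : ∀ g, g ∈ H ↔ m • e g = 0 := fun g => Iff.rfl
  let B : AddSubgroup A := (nsmulAddMonoidHom (α := A) m).ker
  have hB : ∀ v, v ∈ B ↔ m • v = 0 := fun v => AddMonoidHom.mem_ker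
  have hcard : Nat.card H = Nat.card B :=
    Nat.card_congr (e.subtypeEquiv (fun g => by rw [hH, hB]))
  have hidx : H.index = B.index := by
    have h2 := H.card_mul_index
    have h3 := B.card_mul_index
    rw [Nat.card_congr e, ← h3, hcard] at h2
    exact Nat.eq_of_mul_eq_mul_left Nat.card_pos h2
  refine ⟨H, hH, ?_, ?_⟩
  · intro q hq hd
    rw [hcard] at hd
    have : Fact q.Prime := ⟨hq⟩
    obtain ⟨b, hb⟩ := exists_prime_addOrderOf_dvd_card' q hd
    rw [← hb]
    apply addOrderOf_dvd_of_nsmul_eq_zero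
    apply Subtype.ext
    exact (hB _).1 b.2
  · intro q hq hd
    rw [hidx] at hd
    have : Fact q.Prime := ⟨hq⟩
    obtain ⟨b, hb⟩ := exists_prime_addOrderOf_dvd_card' (G := A ⧸ B) q hd
    rw [← hb]
    apply addOrderOf_dvd_of_nsmul_eq_zero
    induction b using QuotientAddGroup.induction_on with
    | H v =>
      rw [← QuotientAddGroup.mk_nsmul, QuotientAddGroup.eq_zero_iff, hB, ← mul_smul]
      exact hmn v

theorem rump_abstract_s18 {G : Type u} {X : Type*} [Group G] [Finite G] [Fintype X] [DecidableEq X]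
    [MulAction G X] (d : ℕ) (hd0 : d ≠ 0) (e : G ≃ (X → ZMod d))
    (hmul : ∀ g h, e (g * h) = e g + fun y => e h (g⁻¹ • y))
    (hfix : ∀ (x : X) (c : ZMod d), e.symm (Pi.single x c) • x = x)
    (x0 : X) (htr : ∀ x : X, ∃ g : G, g • x0 = x) : ∀ x : X, x = x0 := by
  classical
  let lam : G → ((X → ZMod d) ≃+ (X → ZMod d)) := fun g =>
    { toFun := fun w y => w (g⁻¹ • y)
      invFun := fun w y => w (g • y)
      left_inv := fun w => by funext y; simp
      right_inv := fun w => by funext y; simp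
      map_add' := fun v w => rfl }
  have hmul' : ∀ g h, e (g * h) = e g + lam g (e h) := hmul
  have hkill : ∀ m n : ℕ, m * n = d → ∀ v : X → ZMod d, (m * n) • v = 0 := by
    intro m n hmn v
    rw [hmn]; funext y; simp
  have hhall : RumpHall G := by
    intro p hp
    obtain ⟨a, m, hm, hdm⟩ := Nat.exists_eq_pow_mul_and_not_dvd hd0 p hp.ne_one
    obtain ⟨H, -, h1, h2⟩ := rump_ker e lam hmul' m (p ^ a) (hkill _ _ (by rw [hdm, mul_comm]))
    refine ⟨H, fun q hq hqd => ?_, fun h => hm (h1 p hp h)⟩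
    exact (Nat.prime_dvd_prime_iff_eq hq hp).1 (hq.dvd_of_dvd_pow (h2 q hq hqd))
  by_contra! hne
  obtain ⟨x1, hx1⟩ := hne
  let K : Subgroup G := MulAction.stabilizer G x0
  have hK : K ≠ ⊤ := by
    intro h
    obtain ⟨g, hg⟩ := htr x1
    have : g ∈ K := by rw [h]; trivial
    exact hx1 (hg.symm.trans (MulAction.mem_stabilizer_iff.1 this))
  obtain ⟨L, hKL, hL, r, hr, hLr⟩ := rump_prime_power_index (Nat.card G) G rfl hhall K hK
  obtain ⟨a, m, hm, hdm⟩ := Nat.exists_eq_pow_mul_and_not_dvd hd0 r hr.ne_one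
  obtain ⟨R, hR, hR1, hR2⟩ := rump_ker e lam hmul' (r ^ a) m (hkill _ _ hdm.symm)
  have hcop : Nat.Coprime R.index L.index := by
    apply Nat.Coprime.symm
    apply Nat.coprime_of_dvd
    intro q hq h1 h2
    have := hLr q hq h1
    subst this
    exact hm (hR2 q hq h2)
  obtain ⟨hrel, hex⟩ := rump_exists_mul L R hcop.symm
  have : Fact r.Prime := ⟨hr⟩
  have hRp : IsPGroup r R := by
    apply IsPGroup.of_card (n := (Nat.card R).primeFactorsList.length)
    apply Nat.eq_prime_pow_of_unique_prime_dvd Nat.card_pos.ne'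
    intro q hq hqd
    exact (Nat.prime_dvd_prime_iff_eq hq hr).1 (hq.dvd_of_dvd_pow (hR1 q hq hqd))
  have hnil : Group.IsNilpotent R := hRp.isNilpotent
  have hsub : L.subgroupOf R ≠ ⊤ := by
    intro h
    have h1 : L.relIndex R = 1 := by
      rw [Subgroup.relIndex, h, Subgroup.index_top]
    rw [(rump_exists_mul R L hcop).1] at h1
    exact hL (Subgroup.index_eq_one.1 h1)
  obtain ⟨N, hN, hLN⟩ := (eq_top_or_exists_le_coatom (L.subgroupOf R)).resolve_left hsub
  have hNn : N.Normal := Subgroup.NormalizerCondition.normal_of_coatom N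
    (Group.normalizerCondition_of_isNilpotent) hN
  have hsing : ∀ (x : X) (c : ZMod d), (r ^ a) • c = 0 →
      ∃ h : e.symm (Pi.single x c) ∈ R, (⟨e.symm (Pi.single x c), h⟩ : R) ∈ N := by
    intro x c hc
    have hh : e.symm (Pi.single x c) ∈ R := by
      rw [hR, Equiv.apply_symm_apply, ← Pi.single_smul, hc, Pi.single_zero]
    refine ⟨hh, ?_⟩
    have hfx := hfix x c
    generalize e.symm (Pi.single x c) = t at hh hfx
    obtain ⟨g, hg⟩ := htr x
    obtain ⟨ρ, hρ, l, hl, hgl⟩ := hex g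
    have h1 : l⁻¹ * (ρ⁻¹ * t * ρ) * l ∈ K := by
      rw [MulAction.mem_stabilizer_iff]
      have h2 : l⁻¹ * (ρ⁻¹ * t * ρ) * l = g⁻¹ * t * g := by rw [hgl]; group
      rw [h2, mul_smul, mul_smul, hg, hfx, ← hg, inv_smul_smul]
    have h2 : ρ⁻¹ * t * ρ ∈ L := by
      have h3 := L.mul_mem (L.mul_mem hl (hKL h1)) (L.inv_mem hl)
      convert h3 using 1
      group
    have h3 : ((⟨ρ, hρ⟩ : R)⁻¹ * ⟨t, hh⟩ * ⟨ρ, hρ⟩ : R) ∈ N := hLN h2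
    have h4 := hNn.conj_mem _ h3 ⟨ρ, hρ⟩
    convert h4 using 1
    group
  have hall : ∀ (v : X → ZMod d), (r ^ a) • v = 0 → ∀ s : Finset X,
      ∃ h : e.symm (∑ x ∈ s, Pi.single x (v x)) ∈ R,
        (⟨e.symm (∑ x ∈ s, Pi.single x (v x)), h⟩ : R) ∈ N := by
    intro v hv s
    induction s using Finset.induction_on with
    | empty =>
      have h1 : e 1 = 0 := by
        have h2 := hmul 1 1
        simpa using h2
      have h2 : e.symm (∑ x ∈ (∅ : Finset X), Pi.single x (v x)) = 1 := by
        rw [Finset.sum_empty, ← h1, Equiv.symm_apply_apply]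
      rw [h2]
      exact ⟨R.one_mem, N.one_mem⟩
    | insert x s hx ih =>
      obtain ⟨h, hhN⟩ := ih
      rw [Finset.sum_insert hx, add_comm]
      generalize (∑ x ∈ s, Pi.single x (v x) : X → ZMod d) = w at h hhN
      obtain ⟨k, hkN⟩ := hsing ((e.symm w)⁻¹ • x) (v x) (congrFun hv x)
      have h5 : e.symm (w + Pi.single x (v x)) =
          e.symm w * e.symm (Pi.single ((e.symm w)⁻¹ • x) (v x)) := by
        rw [Equiv.symm_apply_eq, hmul]
        simp only [Equiv.apply_symm_apply]
        congr 1
        funext y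
        simp [Pi.single_apply]
      rw [h5]
      exact ⟨R.mul_mem h k, N.mul_mem hhN hkN⟩
  apply hN.1
  rw [eq_top_iff]
  rintro ⟨g, hg⟩ -
  obtain ⟨h, hhN⟩ := hall (e g) ((hR g).1 hg) Finset.univ
  have h6 : e.symm (∑ x, Pi.single x (e g x)) = g := by
    rw [Finset.univ_sum_single, Equiv.symm_apply_apply]
  convert hhN using 2
  exact h6.symm

structure RumpG (X : Type*) (d : ℕ) where
  val : X → ZMod d

theorem rump_phi {X : Type*} [Fintype X] [DecidableEq X] (sig : X → Equiv.Perm X)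
    (hcyc : ∀ x y, sig (sig x y) * sig x = sig (sig y x) * sig y)
    (hid : ∀ x, sig x x = x) :
    ∃ d : ℕ, d ≠ 0 ∧ ∃ F : (X → ZMod d) → Equiv.Perm X → Equiv.Perm X,
      (∀ s, F 0 s = s) ∧ (∀ v w s, F (v + w) s = F w (F v s)) ∧
      (∀ x s, F (Pi.single x 1) s = sig (s x) * s) ∧
      (∀ x c s, F (Pi.single x c) s x = s x) ∧
      (∀ v s t, F v (s * t) = F (fun y => v (t⁻¹ y)) s * t) := by
  classical
  let f : X → Equiv.Perm X → Equiv.Perm X := fun x s => sig (s x) * s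
  have hfcomm : ∀ x y s, f x (f y s) = f y (f x s) := by
    intro x y s
    change sig (sig (s y) (s x)) * (sig (s y) * s) = sig (sig (s x) (s y)) * (sig (s x) * s)
    rw [← mul_assoc, ← mul_assoc, hcyc]
  have hfx : ∀ x s, f x s x = s x := fun x s => hid (s x)
  have hfinj : ∀ x, Function.Injective (f x) := by
    intro x s t h
    have h1 : s x = t x := by rw [← hfx x s, ← hfx x t, h]
    change sig (s x) * s = sig (t x) * t at h
    rw [h1] at h
    exact mul_left_cancel h
  let φ : X → Equiv.Perm (Equiv.Perm X) := fun x =>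
    Equiv.ofBijective (f x) (Finite.injective_iff_bijective.1 (hfinj x))
  have hφ : ∀ x s, φ x s = f x s := fun x s => rfl
  let d := Fintype.card (Equiv.Perm (Equiv.Perm X))
  have hd : d ≠ 0 := Fintype.card_ne_zero
  have hpow : ∀ x, φ x ^ d = 1 := fun x => pow_card_eq_one
  have : NeZero d := ⟨hd⟩
  have hcomm : ∀ x y, Commute (φ x) (φ y) := fun x y => Equiv.ext fun s => hfcomm x y s
  let ψ : X → Multiplicative (ZMod d) →* Equiv.Perm (Equiv.Perm X) := fun x =>
    { toFun := fun c => φ x ^ c.toAdd.val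
      map_one' := by simp
      map_mul' := fun a b => by
        rw [← pow_add, toAdd_mul, ZMod.val_add, ← pow_eq_pow_mod _ (hpow x)] }
  let Ψ : (X → Multiplicative (ZMod d)) →* Equiv.Perm (Equiv.Perm X) :=
    MonoidHom.noncommPiCoprod ψ (fun x y _ a b => (hcomm x y).pow_pow _ _)
  let F : (X → ZMod d) → Equiv.Perm X → Equiv.Perm X :=
    fun v => Ψ (fun x => Multiplicative.ofAdd (v x))
  have hF0 : ∀ s, F 0 s = s := fun s => by
    change Ψ 1 s = s
    rw [map_one]; rfl
  have hFadd' : ∀ v w s, F (v + w) s = F v (F w s) := fun v w s => by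
    change Ψ ((fun x => Multiplicative.ofAdd (v x)) * (fun x => Multiplicative.ofAdd (w x))) s = _
    rw [map_mul]; rfl
  have hFadd : ∀ v w s, F (v + w) s = F w (F v s) := fun v w s => by
    rw [add_comm, hFadd']
  have hFs : ∀ x c s, F (Pi.single x c) s = (φ x ^ c.val) s := by
    intro x c s
    have h1 : (fun y => Multiplicative.ofAdd ((Pi.single x c : X → ZMod d) y)) =
        Pi.mulSingle x (Multiplicative.ofAdd c) := by
      funext y
      by_cases h : y = x
      · subst h; simp
      · simp [h]
    change Ψ _ s = _
    rw [h1]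
    have h2 : Ψ (Pi.mulSingle x (Multiplicative.ofAdd c)) = ψ x (Multiplicative.ofAdd c) :=
      MonoidHom.noncommPiCoprod_mulSingle (ϕ := ψ) x _
    rw [h2]
    rfl
  have hpowf : ∀ x (n : ℕ) s, (φ x ^ n) s x = s x := by
    intro x n
    induction n with
    | zero => intro s; rfl
    | succ n ih => intro s; rw [pow_succ, Equiv.Perm.mul_apply, ih, hφ, hfx]
  have hkey : ∀ v s t, F v (s * t) = F (fun y => v (t⁻¹ y)) s * t := by
    intro v
    induction v using Pi.single_induction with
    | zero => intro s t; rw [hF0]; change _ = F 0 s * t; rw [hF0]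
    | add v w hv hw =>
      intro s t
      rw [hFadd, hv, hw]
      change _ = F ((fun y => v (t⁻¹ y)) + (fun y => w (t⁻¹ y))) s * t
      rw [hFadd]
    | single x c =>
      intro s t
      have h1 : (fun y => (Pi.single x c : X → ZMod d) (t⁻¹ y)) = Pi.single (t x) c := by
        funext y
        rw [Pi.single_apply, Pi.single_apply]
        exact if_congr Equiv.Perm.inv_eq_iff_eq rfl rfl
      rw [h1, hFs, hFs]
      generalize c.val = n
      induction n generalizing s with
      | zero => rfl
      | succ n ih =>
        rw [pow_succ, pow_succ, Equiv.Perm.mul_apply, Equiv.Perm.mul_apply, ← ih]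
        rfl
  refine ⟨d, hd, F, hF0, hFadd, ?_, ?_, hkey⟩
  · intro x s
    rw [hFs]
    have h2 : (φ x ^ (1 : ZMod d).val) = φ x := by
      rw [ZMod.val_one_eq_one_mod, ← pow_eq_pow_mod _ (hpow x), pow_one]
    rw [h2, hφ]
  · intro x c s
    rw [hFs, hpowf]

theorem rump_main {X : Type u} [Fintype X] [DecidableEq X] (sig : X → Equiv.Perm X)
    (hcyc : ∀ x y, sig (sig x y) * sig x = sig (sig y x) * sig y)
    (hid : ∀ x, sig x x = x) (x0 x1 : X) (hne : x1 ≠ x0) :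
    ∃ Y : Set X, Y.Nonempty ∧ Yᶜ.Nonempty ∧ ∀ a b, sig a b ∈ Y ↔ b ∈ Y := by
  obtain ⟨d, hd, F, hF0, hFadd, hF1, hFfix, hFkey⟩ := rump_phi sig hcyc hid
  have : NeZero d := ⟨hd⟩
  let S : (X → ZMod d) → Equiv.Perm X := fun v => F v 1
  have hS0 : S 0 = 1 := hF0 1
  have hSadd : ∀ v w, S (v + fun y => w (S v y)) = S w * S v := by
    intro v w
    change F _ 1 = _
    rw [hFadd]
    have h1 := hFkey (fun y => w (S v y)) 1 (S v)
    rw [one_mul] at h1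
    change F _ (S v) = _
    rw [h1]
    have h2 : (fun y => w (S v ((S v)⁻¹ y))) = w := by funext y; simp
    rw [h2]
  let e : RumpG X d ≃ (X → ZMod d) := ⟨RumpG.val, RumpG.mk, fun _ => rfl, fun _ => rfl⟩
  letI : Mul (RumpG X d) := ⟨fun v w => ⟨v.val + fun y => w.val (S v.val y)⟩⟩
  letI : One (RumpG X d) := ⟨⟨0⟩⟩
  letI : Inv (RumpG X d) := ⟨fun v => ⟨fun y => - v.val ((S v.val)⁻¹ y)⟩⟩
  have hm : ∀ v w : RumpG X d, (v * w).val = v.val + fun y => w.val (S v.val y) := fun _ _ => rfl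
  have ho : (1 : RumpG X d).val = 0 := rfl
  have hi : ∀ v : RumpG X d, (v⁻¹).val = fun y => - v.val ((S v.val)⁻¹ y) := fun _ => rfl
  have hmulinv : ∀ v : RumpG X d, v * v⁻¹ = 1 := by
    intro v
    apply e.injective
    change (v * v⁻¹).val = (1 : RumpG X d).val
    rw [hm, ho, hi]
    funext y
    simp
  letI : Group (RumpG X d) := Group.ofRightAxioms
    (by
      intro a b c
      apply e.injective
      change (a * b * c).val = (a * (b * c)).val
      rw [hm, hm, hm, hm, hSadd]
      funext y
      simp [add_assoc])
    (by
      intro a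
      apply e.injective
      change (a * 1).val = a.val
      rw [hm, ho]
      funext y
      simp)
    hmulinv
  have : Finite (RumpG X d) := Finite.of_equiv _ e.symm
  letI : MulAction (RumpG X d) X :=
    { smul := fun v x => (S v.val)⁻¹ x
      one_smul := fun x => by
        change (S (1 : RumpG X d).val)⁻¹ x = x
        rw [ho, hS0]; rfl
      mul_smul := fun v w x => by
        change (S (v * w).val)⁻¹ x = (S v.val)⁻¹ ((S w.val)⁻¹ x)
        rw [hm, hSadd, mul_inv_rev]; rfl }
  have hsm : ∀ (v : RumpG X d) (x : X), v • x = (S v.val)⁻¹ x := fun _ _ => rfl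
  have hsmi : ∀ (v : RumpG X d) (x : X), v⁻¹ • x = S v.val x := by
    intro v x
    rw [inv_smul_eq_iff, hsm]; simp
  refine ⟨MulAction.orbit (RumpG X d) x0, ⟨x0, MulAction.mem_orbit_self x0⟩, ?_, ?_⟩
  · by_contra h
    rw [Set.not_nonempty_iff_eq_empty, Set.compl_empty_iff] at h
    refine hne (rump_abstract_s18 d hd e ?_ ?_ x0 ?_ x1)
    · intro g h
      simp only [hsmi]
      rfl
    · intro x c
      rw [hsm, Equiv.Perm.inv_eq_iff_eq]
      exact (hFfix x c 1).symm
    · intro x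
      have : x ∈ MulAction.orbit (RumpG X d) x0 := by rw [h]; trivial
      exact this
  · intro a b
    have h1 : sig a b = (⟨Pi.single a 1⟩ : RumpG X d)⁻¹ • b := by
      rw [hsmi]
      change _ = F _ 1 b
      rw [hF1]
      rfl
    rw [h1]
    generalize (⟨Pi.single a 1⟩ : RumpG X d)⁻¹ = g
    constructor
    · rintro ⟨k, hk⟩
      refine ⟨g⁻¹ * k, ?_⟩
      change (g⁻¹ * k) • x0 = b
      rw [mul_smul, inv_smul_eq_iff]
      exact hk
    · rintro ⟨k, hk⟩
      refine ⟨g * k, ?_⟩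
      change (g * k) • x0 = g • b
      rw [mul_smul]
      exact congrArg (g • ·) hk

/-- Rump: A finite non-degenerate cycle set with identity squaring map
and more than one element is decomposable. -/
theorem stmt18 {X : Type*} [Fintype X] (op : X → X → X)
    (hbij : ∀ x, Function.Bijective (op x))
    (hcyc : ∀ x y z, op (op x y) (op x z) = op (op y x) (op y z))
    (hid : ∀ x, op x x = x)
    (hcard : 1 < Fintype.card X) :
    ∃ Y₁ Y₂ : Set X, Y₁.Nonempty ∧ Y₂.Nonempty ∧ Disjoint Y₁ Y₂ ∧
      Y₁ ∪ Y₂ = Set.univ ∧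
      (∀ a ∈ Y₁, ∀ b ∈ Y₁, op a b ∈ Y₁) ∧
      (∀ a ∈ Y₂, ∀ b ∈ Y₂, op a b ∈ Y₂) := by
  classical
  obtain ⟨x0, x1, hne⟩ := Fintype.one_lt_card_iff.1 hcard
  obtain ⟨Y, h1, h2, h3⟩ := rump_main (fun x => Equiv.ofBijective (op x) (hbij x))
    (fun x y => Equiv.ext fun z => hcyc x y z) hid x0 x1 hne.symm
  refine ⟨Y, Yᶜ, h1, h2, disjoint_compl_right, Set.union_compl_self Y,
    fun a _ b hb => (h3 a b).2 hb, fun a _ b hb h => hb ((h3 a b).1 h)⟩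
end
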